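/- Let 0<ρ<1, let S_j(x)=ρx+b_j (j=1,…,m) with b_1<⋯<b_m, let K be the attractor (the unique nonempty compact set with K=⋃_j S_j(K)), let (p_j) be a probability vector with p_j>0, and let μ be the Borel probability measure on ℝ with μ = Σ_j p_j·μ∘S_j^{−1}; assume μ has no atoms. Let s = dim_H K and assume 0 < 𝓗^s(K) < ∞ and that there exists c>0 with c⁻¹r^s ≤ 𝓗^s(K∩[x−r,x+r]) ≤ c·r^s for all x∈K and 0<r<1. Suppose there exist: an irreducible subshift of finite type Σ_A over the alphabet {1,…,k}, a positively irreducible tuple 𝐌=(M_1,…,M_k) of nonnegative N×N matrices, and closed intervals Δ_I indexed by the admissible words I of Σ_A (including the empty word ε), satisfying: (C1) for each n, the interiors of the intervals Δ_I, I∈𝓛_n(Σ_A), are pairwise disjoint subintervals of Δ_ε, and Δ_{i_1⋯i_n} ⊆ Δ_{i_1⋯i_{n−1}}; (C2) there is c'>0 with c'⁻¹ρ^n ≤ |Δ_I| ≤ c'ρ^n for all I∈𝓛_n(Σ_A); (C3) K∩Δ_ε = K∩(⋃_{I∈𝓛_n(Σ_A)}Δ_I) for all n, and the endpoints of every Δ_I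 lie in K; (C4) there is c''>0 with c''⁻¹‖M_{i_1}⋯M_{i_n}‖ ≤ μ(Δ_{i_1⋯i_n}) ≤ c''‖M_{i_1}⋯M_{i_n}‖ for all I=i_1⋯i_n∈𝓛_n(Σ_A); (C5) for every word i_1⋯i_n over {1,…,k}, M_{i_1}⋯M_{i_n} ≠ 0 if and only if i_1⋯i_n∈𝓛_n(Σ_A). Assume also s = h_top(Σ_A)/log(1/ρ), where h_top(Σ_A) = lim_n (1/n) log #𝓛_n(Σ_A). Then μ is absolutely continuous with respect to 𝓗^s restricted to K if and only if 𝐌 has a uniform Lyapunov exponent modulo 0. -/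

import Mathlib

open Filter Real MeasureTheory

/-- The matrix norm `‖A‖ = ∑_{i,j} |A i j|`. -/
noncomputable def mnorm {d : ℕ} (A : Matrix (Fin d) (Fin d) ℝ) : ℝ :=
  ∑ i, ∑ j, |A i j|

/-- The product `M_{j₁} ⋯ M_{jₙ}` along a word `w = j₁⋯jₙ`. -/
noncomputable def wordProd {d k : ℕ} (M : Fin k → Matrix (Fin d) (Fin d) ℝ)
    (w : List (Fin k)) : Matrix (Fin d) (Fin d) ℝ :=
  (w.map M).prod

/-- `𝐌` has a uniform Lyapunov exponent modulo 0. -/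
def HasULE {d k : ℕ} (M : Fin k → Matrix (Fin d) (Fin d) ℝ) : Prop :=
  ∃ C : ℝ, 0 < C ∧ ∃ lam : ℝ, ∀ w : List (Fin k), w ≠ [] →
    wordProd M w = 0 ∨
      (C⁻¹ * Real.exp (lam * w.length) ≤ mnorm (wordProd M w) ∧
        mnorm (wordProd M w) ≤ C * Real.exp (lam * w.length))

/-- `𝐌` is irreducible: no nonzero proper subspace is invariant under all `M i`. -/
def MatIrred {d k : ℕ} (M : Fin k → Matrix (Fin d) (Fin d) ℝ) : Prop :=
  ∀ V : Submodule ℝ (Fin d → ℝ),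
    (∀ i, ∀ v ∈ V, (M i).mulVec v ∈ V) → V = ⊥ ∨ V = ⊤

/-- `𝐌` is positively irreducible. -/
def PosIrred {d k : ℕ} (M : Fin k → Matrix (Fin d) (Fin d) ℝ) : Prop :=
  (∀ i a b, 0 ≤ M i a b) ∧
    ∃ ℓ : ℕ, 1 ≤ ℓ ∧ ∀ a b, 0 < (∑ j ∈ Finset.Icc 1 ℓ, (∑ i, M i) ^ j) a b

/-- A single nonnegative matrix is positively irreducible:
some partial sum of its powers is entrywise positive. -/
def PosIrredMat {n : ℕ} (A : Matrix (Fin n) (Fin n) ℝ) : Prop :=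
  ∃ ℓ : ℕ, 1 ≤ ℓ ∧ ∀ a b, 0 < (∑ j ∈ Finset.Icc 1 ℓ, A ^ j) a b

/-- A word `w` is admissible for the subshift of finite type determined by the
0-1 matrix `A` if it occurs as a consecutive string in some sequence of the subshift. -/
def Adm {k : ℕ} (A : Matrix (Fin k) (Fin k) ℝ) (w : List (Fin k)) : Prop :=
  ∃ x : ℕ → Fin k, (∀ t : ℕ, A (x t) (x (t + 1)) = 1) ∧
    ∃ p : ℕ, ∀ i : Fin w.length, x (p + i) = w.get i

section MatrixNorm

variable {d k : ℕ}

lemma mnorm_nonneg (X : Matrix (Fin d) (Fin d) ℝ) : 0 ≤ mnorm X :=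
  Finset.sum_nonneg fun _ _ => Finset.sum_nonneg fun _ _ => abs_nonneg _

lemma abs_entry_le_mnorm (X : Matrix (Fin d) (Fin d) ℝ) (a b : Fin d) : |X a b| ≤ mnorm X :=
  (Finset.single_le_sum (f := fun b => |X a b|) (fun _ _ => abs_nonneg _)
    (Finset.mem_univ b)).trans
    (Finset.single_le_sum (f := fun a => ∑ b, |X a b|)
      (fun _ _ => Finset.sum_nonneg fun _ _ => abs_nonneg _) (Finset.mem_univ a))

lemma mnorm_eq_zero_iff {X : Matrix (Fin d) (Fin d) ℝ} : mnorm X = 0 ↔ X = 0 := by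
  constructor
  · intro h
    ext a b
    have := abs_entry_le_mnorm X a b
    rw [h] at this
    exact abs_nonpos_iff.1 this
  · rintro rfl
    simp [mnorm]

lemma mnorm_pos_iff {X : Matrix (Fin d) (Fin d) ℝ} : 0 < mnorm X ↔ X ≠ 0 := by
  rw [(mnorm_nonneg X).lt_iff_ne, ne_comm, Ne, mnorm_eq_zero_iff]

lemma mnorm_eq_sum {X : Matrix (Fin d) (Fin d) ℝ} (hX : ∀ a b, 0 ≤ X a b) :
    mnorm X = ∑ a, ∑ b, X a b :=
  Finset.sum_congr rfl fun _ _ => Finset.sum_congr rfl fun _ _ => abs_of_nonneg (hX _ _)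

lemma mnorm_one [NeZero d] : 1 ≤ mnorm (1 : Matrix (Fin d) (Fin d) ℝ) := by
  have := abs_entry_le_mnorm (1 : Matrix (Fin d) (Fin d) ℝ) 0 0
  simpa using this

lemma mnorm_mul_le (X Y : Matrix (Fin d) (Fin d) ℝ) : mnorm (X * Y) ≤ mnorm X * mnorm Y := by
  have h : ∀ a b, |(X * Y) a b| ≤ ∑ c, |X a c| * |Y c b| := fun a b => by
    rw [Matrix.mul_apply]
    refine (Finset.abs_sum_le_sum_abs _ _).trans_eq ?_
    simp_rw [abs_mul]
  calc mnorm (X * Y) ≤ ∑ a, ∑ b, ∑ c, |X a c| * |Y c b| :=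
        Finset.sum_le_sum fun a _ => Finset.sum_le_sum fun b _ => h a b
    _ = ∑ a, ∑ c, |X a c| * ∑ b, |Y c b| := by
        refine Finset.sum_congr rfl fun a _ => ?_
        rw [Finset.sum_comm]
        simp_rw [Finset.mul_sum]
    _ ≤ ∑ a, ∑ c, |X a c| * mnorm Y := by
        refine Finset.sum_le_sum fun a _ => Finset.sum_le_sum fun c _ => ?_
        refine mul_le_mul_of_nonneg_left ?_ (abs_nonneg _)
        exact Finset.single_le_sum (f := fun c => ∑ b, |Y c b|)
          (fun _ _ => Finset.sum_nonneg fun _ _ => abs_nonneg _) (Finset.mem_univ c)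
    _ = mnorm X * mnorm Y := by simp_rw [← Finset.sum_mul]; rfl

lemma mnorm_sum {ι : Type*} (S : Finset ι) (f : ι → Matrix (Fin d) (Fin d) ℝ)
    (hf : ∀ i ∈ S, ∀ a b, 0 ≤ f i a b) : mnorm (∑ i ∈ S, f i) = ∑ i ∈ S, mnorm (f i) := by
  rw [mnorm_eq_sum, Finset.sum_congr rfl fun i hi => mnorm_eq_sum (hf i hi)]
  · rw [Finset.sum_comm]
    refine Finset.sum_congr rfl fun a _ => ?_
    rw [Finset.sum_comm]
    simp [Matrix.sum_apply]
  · intro a b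
    rw [Matrix.sum_apply]
    exact Finset.sum_nonneg fun i hi => hf i hi a b

/-- Inserting a matrix with entries at least `η` bounds the norm of a product from below. -/
lemma le_mnorm_mul_mul {X Q Y : Matrix (Fin d) (Fin d) ℝ} {η : ℝ} (hη : 0 ≤ η)
    (hX : ∀ a b, 0 ≤ X a b) (hQ : ∀ a b, η ≤ Q a b) (hY : ∀ a b, 0 ≤ Y a b) :
    η * mnorm X * mnorm Y ≤ mnorm (X * Q * Y) := by
  have hQ0 : ∀ a b, 0 ≤ Q a b := fun a b => hη.trans (hQ a b)
  have hXQ : ∀ a b, η * ∑ c, X a c ≤ (X * Q) a b := fun a b => by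
    rw [Matrix.mul_apply, Finset.mul_sum]
    refine Finset.sum_le_sum fun c _ => ?_
    rw [mul_comm]
    exact mul_le_mul_of_nonneg_left (hQ c b) (hX a c)
  have hXQ0 : ∀ a b, 0 ≤ (X * Q) a b := fun a b =>
    (mul_nonneg hη (Finset.sum_nonneg fun c _ => hX a c)).trans (hXQ a b)
  rw [mnorm_eq_sum hX, mnorm_eq_sum hY, mnorm_eq_sum fun a b => ?_]
  · calc η * (∑ a, ∑ b, X a b) * ∑ a, ∑ b, Y a b
        = ∑ a, ∑ c, ∑ b, (η * ∑ e, X a e) * Y c b := by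
          simp_rw [← Finset.mul_sum, ← Finset.sum_mul, ← Finset.mul_sum]
      _ ≤ ∑ a, ∑ c, ∑ b, (X * Q) a c * Y c b :=
          Finset.sum_le_sum fun a _ => Finset.sum_le_sum fun c _ => Finset.sum_le_sum fun b _ =>
            mul_le_mul_of_nonneg_right (hXQ a c) (hY c b)
      _ = ∑ a, ∑ b, (X * Q * Y) a b := by
          refine Finset.sum_congr rfl fun a _ => ?_
          rw [Finset.sum_comm]
          simp [Matrix.mul_apply (M := X * Q)]
  · rw [Matrix.mul_apply]
    exact Finset.sum_nonneg fun c _ => mul_nonneg (hXQ0 a c) (hY c b)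

lemma wordProd_append (M : Fin k → Matrix (Fin d) (Fin d) ℝ) (u w : List (Fin k)) :
    wordProd M (u ++ w) = wordProd M u * wordProd M w := by
  simp [wordProd]

lemma wordProd_nil (M : Fin k → Matrix (Fin d) (Fin d) ℝ) : wordProd M [] = 1 := by
  simp [wordProd]

lemma wordProd_nonneg {M : Fin k → Matrix (Fin d) (Fin d) ℝ} (hM : ∀ i a b, 0 ≤ M i a b)
    (w : List (Fin k)) : ∀ a b, 0 ≤ wordProd M w a b := by
  induction w with
  | nil =>
    intro a b
    rw [wordProd_nil, Matrix.one_apply]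
    split_ifs <;> norm_num
  | cons i w ih =>
    intro a b
    have : wordProd M (i :: w) = M i * wordProd M w := by simp [wordProd]
    rw [this, Matrix.mul_apply]
    exact Finset.sum_nonneg fun c _ => mul_nonneg (hM i a c) (ih c b)

end MatrixNorm

section Words

/-- The finite set of all words of length `n` over `Fin k`. -/
noncomputable def wordsOfLength (k n : ℕ) : Finset (List (Fin k)) :=
  (List.finite_length_eq (Fin k) n).toFinset

variable {d k : ℕ}

@[simp]
lemma mem_wordsOfLength {n : ℕ} {w : List (Fin k)} : w ∈ wordsOfLength k n ↔ w.length = n := by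
  simp [wordsOfLength]

lemma sum_wordsOfLength_add {β : Type*} [AddCommMonoid β] (n m : ℕ) (f : List (Fin k) → β) :
    ∑ w ∈ wordsOfLength k (n + m), f w =
      ∑ u ∈ wordsOfLength k n, ∑ v ∈ wordsOfLength k m, f (u ++ v) := by
  rw [← Finset.sum_product']
  symm
  refine Finset.sum_nbij' (fun p => p.1 ++ p.2) (fun w => (w.take n, w.drop n)) ?_ ?_ ?_ ?_ ?_
  · rintro ⟨u, v⟩ h
    simp only [Finset.mem_product, mem_wordsOfLength] at h
    simp [h.1, h.2]
  · intro w h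
    simp only [mem_wordsOfLength] at h
    simp [h]
  · rintro ⟨u, v⟩ h
    simp only [Finset.mem_product, mem_wordsOfLength] at h
    ext1
    · simp [← h.1]
    · simp [← h.1]
  · intro w _
    simp
  · intro p _
    rfl

lemma wordsOfLength_zero : wordsOfLength k 0 = {[]} := by
  ext w
  simp

lemma sum_wordsOfLength_one {β : Type*} [AddCommMonoid β] (f : List (Fin k) → β) :
    ∑ w ∈ wordsOfLength k 1, f w = ∑ i, f [i] := by
  symm
  refine Finset.sum_bij (fun i _ => [i]) ?_ ?_ ?_ ?_
  · simp
  · simp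
  · intro w hw
    obtain ⟨i, rfl⟩ := List.length_eq_one_iff.1 (mem_wordsOfLength.1 hw)
    exact ⟨i, by simp, rfl⟩
  · simp

lemma sum_wordProd (M : Fin k → Matrix (Fin d) (Fin d) ℝ) (n : ℕ) :
    ∑ w ∈ wordsOfLength k n, wordProd M w = (∑ i, M i) ^ n := by
  induction n with
  | zero => simp [wordsOfLength_zero, wordProd_nil]
  | succ n ih =>
    rw [sum_wordsOfLength_add, pow_succ, ← ih, Finset.sum_mul]
    refine Finset.sum_congr rfl fun u _ => ?_
    rw [sum_wordsOfLength_one, Finset.mul_sum]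
    refine Finset.sum_congr rfl fun i _ => ?_
    rw [wordProd_append]
    simp [wordProd]

lemma sum_mnorm_wordProd {M : Fin k → Matrix (Fin d) (Fin d) ℝ} (hM : ∀ i a b, 0 ≤ M i a b)
    (n : ℕ) : ∑ w ∈ wordsOfLength k n, mnorm (wordProd M w) = mnorm ((∑ i, M i) ^ n) := by
  rw [← sum_wordProd, mnorm_sum _ _ fun w _ => wordProd_nonneg hM w]

end Words

section Perron

variable {d k : ℕ}

lemma pow_entry_nonneg {B : Matrix (Fin d) (Fin d) ℝ} (hB : ∀ a b, 0 ≤ B a b) (n : ℕ) :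
    ∀ a b, 0 ≤ (B ^ n) a b := by
  induction n with
  | zero =>
    intro a b
    rw [pow_zero, Matrix.one_apply]
    split_ifs <;> norm_num
  | succ n ih =>
    intro a b
    rw [pow_succ, Matrix.mul_apply]
    exact Finset.sum_nonneg fun c _ => mul_nonneg (ih a c) (hB c b)

/-- A nonnegative matrix with powers of norm bounded above and below and an entrywise positive
partial sum of powers has a positive fixed vector. -/
lemma exists_pos_fixed_vector [NeZero d] {B : Matrix (Fin d) (Fin d) ℝ} {c C : ℝ} {ℓ : ℕ}
    (hB : ∀ a b, 0 ≤ B a b) (hQ : ∀ a b, 0 < (∑ j ∈ Finset.Icc 1 ℓ, B ^ j) a b)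
    (hc : 0 < c) (h1 : ∀ n, c ≤ mnorm (B ^ n)) (h2 : ∀ n, mnorm (B ^ n) ≤ C) :
    ∃ v : Fin d → ℝ, (∀ a, 0 < v a) ∧ B.mulVec v = v := by
  set x : ℕ → Fin d → ℝ := fun j => (B ^ j).mulVec fun _ => 1 with hx
  have hxa : ∀ j a, x j a = ∑ b, (B ^ j) a b := fun j a => by simp [hx, Matrix.mulVec, dotProduct]
  have hx0 : ∀ j a, 0 ≤ x j a := fun j a => by
    rw [hxa]
    exact Finset.sum_nonneg fun b _ => pow_entry_nonneg hB j a b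
  have hxs : ∀ j, ∑ a, x j a = mnorm (B ^ j) := fun j => by
    rw [mnorm_eq_sum (pow_entry_nonneg hB j)]
    simp_rw [hxa]
  have hxC : ∀ j a, x j a ≤ C := fun j a =>
    (Finset.single_le_sum (f := x j) (fun b _ => hx0 j b) (Finset.mem_univ a)).trans
      ((hxs j).le.trans (h2 j))
  have hxB : ∀ j, B.mulVec (x j) = x (j + 1) := fun j => by
    simp only [hx]
    rw [pow_succ', ← Matrix.mulVec_mulVec]
  set V : ℕ → Fin d → ℝ := fun n => ((n : ℝ) + 1)⁻¹ • ∑ j ∈ Finset.range (n + 1), x j with hV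
  have hVa : ∀ n a, V n a = ((n : ℝ) + 1)⁻¹ * ∑ j ∈ Finset.range (n + 1), x j a := fun n a => by
    simp [hV]
  have hpos : ∀ n : ℕ, (0 : ℝ) < (n : ℝ) + 1 := fun n => by positivity
  have hVmem : ∀ n, V n ∈ Set.Icc (0 : Fin d → ℝ) (fun _ => C) := fun n => by
    constructor
    · intro a
      rw [hVa]
      exact mul_nonneg (inv_nonneg.2 (hpos n).le) (Finset.sum_nonneg fun j _ => hx0 j a)
    · intro a
      rw [hVa, inv_mul_le_iff₀ (hpos n)]
      calc ∑ j ∈ Finset.range (n + 1), x j a ≤ ∑ _j ∈ Finset.range (n + 1), C :=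
            Finset.sum_le_sum fun j _ => hxC j a
        _ = ((n : ℝ) + 1) * C := by simp
  obtain ⟨v, hv, φ, hφ, hlim⟩ := isCompact_Icc.tendsto_subseq hVmem
  have hVs : ∀ n, c ≤ ∑ a, V n a := fun n => by
    simp_rw [hVa]
    rw [← Finset.mul_sum, Finset.sum_comm, le_inv_mul_iff₀ (hpos n)]
    calc ((n : ℝ) + 1) * c = ∑ _j ∈ Finset.range (n + 1), c := by simp
      _ ≤ _ := Finset.sum_le_sum fun j _ => (h1 j).trans (hxs j).ge
  have hVB : ∀ n, B.mulVec (V n) = V n + ((n : ℝ) + 1)⁻¹ • (x (n + 1) - x 0) := fun n => by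
    simp only [hV]
    rw [Matrix.mulVec_smul, Matrix.mulVec_sum, ← smul_add]
    congr 1
    simp_rw [hxB]
    have e1 := Finset.sum_range_succ x (n + 1)
    have e2 := Finset.sum_range_succ' x (n + 1)
    rw [e1] at e2
    rw [← add_sub_assoc, e2, add_sub_cancel_right]
  have hcoord := tendsto_pi_nhds.1 hlim
  have hsum : c ≤ ∑ a, v a :=
    ge_of_tendsto' (tendsto_finsetSum Finset.univ fun a _ => hcoord a) fun n => hVs (φ n)
  have herr : Tendsto (fun n : ℕ => ((n : ℝ) + 1)⁻¹ • (x (n + 1) - x 0)) atTop (nhds 0) := by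
    rw [tendsto_pi_nhds]
    intro a
    have hz : Tendsto (fun n : ℕ => ((n : ℝ) + 1)⁻¹ * C) atTop (nhds 0) := by
      have := (tendsto_one_div_add_atTop_nhds_zero_nat (𝕜 := ℝ)).mul_const C
      simpa using this
    refine squeeze_zero_norm (fun n => ?_) hz
    simp only [Pi.smul_apply, Pi.sub_apply, smul_eq_mul, norm_mul, Real.norm_eq_abs]
    rw [abs_of_pos (inv_pos.2 (hpos n))]
    refine mul_le_mul_of_nonneg_left ?_ (inv_nonneg.2 (hpos n).le)
    rw [abs_le]
    constructor <;> linarith [hx0 (n + 1) a, hx0 0 a, hxC (n + 1) a, hxC 0 a]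
  have hfix : B.mulVec v = v := by
    have hcont : Continuous fun w : Fin d → ℝ => B.mulVec w := by fun_prop
    have l1 := (hcont.tendsto v).comp hlim
    have l2 := hlim.add (herr.comp hφ.tendsto_atTop)
    rw [add_zero] at l2
    refine tendsto_nhds_unique l1 (l2.congr fun n => ?_)
    simp only [Function.comp]
    exact (hVB (φ n)).symm
  refine ⟨v, fun a => ?_, hfix⟩
  have hpow : ∀ j, (B ^ j).mulVec v = v := fun j => by
    induction j with
    | zero => simp
    | succ j ih => rw [pow_succ, ← Matrix.mulVec_mulVec, hfix, ih]
  have hQv : (∑ j ∈ Finset.Icc 1 ℓ, B ^ j).mulVec v = (ℓ : ℝ) • v := by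
    rw [Matrix.sum_mulVec]
    simp_rw [hpow]
    ext b
    simp
  have hQva := congrFun hQv a
  have : 0 < (ℓ : ℝ) * v a := by
    rw [← smul_eq_mul, ← Pi.smul_apply, ← hQva]
    obtain ⟨b, -, hb⟩ := Finset.exists_lt_of_sum_lt
      (show ∑ _b : Fin d, (0 : ℝ) < ∑ b, v b by simpa using hc.trans_le hsum)
    exact Finset.sum_pos' (fun b _ => mul_nonneg (hQ a b).le (hv.1 b))
      ⟨b, Finset.mem_univ b, mul_pos (hQ a b) hb⟩
  exact pos_of_mul_pos_right this (Nat.cast_nonneg ℓ)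

lemma pow_mulVec_fixed {B : Matrix (Fin d) (Fin d) ℝ} {v : Fin d → ℝ} (h : B.mulVec v = v)
    (n : ℕ) : (B ^ n).mulVec v = v := by
  induction n with
  | zero => simp
  | succ n ih => rw [pow_succ, ← Matrix.mulVec_mulVec, h, ih]

lemma sum_infix_le (u : List (Fin k)) (p q : ℕ) {f : List (Fin k) → ℝ} (hf : ∀ w, 0 ≤ f w) :
    ∑ x ∈ wordsOfLength k p, ∑ z ∈ wordsOfLength k q, f (x ++ (u ++ z)) ≤
      ∑ w ∈ wordsOfLength k (p + (u.length + q)) with u <:+: w, f w := by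
  rw [Finset.sum_filter, sum_wordsOfLength_add]
  refine Finset.sum_le_sum fun x _ => ?_
  rw [sum_wordsOfLength_add]
  refine le_trans (Finset.sum_le_sum fun z _ => ?_)
    (Finset.single_le_sum (f := fun y => ∑ z ∈ wordsOfLength k q,
      if u <:+: x ++ (y ++ z) then f (x ++ (y ++ z)) else 0)
      (fun y _ => Finset.sum_nonneg fun z _ => ?_) (mem_wordsOfLength.2 (rfl : u.length = _)))
  · rw [if_pos ⟨x, z, by simp⟩]
  · split_ifs
    exacts [hf _, le_rfl]

lemma sum_sum_wordProd (M : Fin k → Matrix (Fin d) (Fin d) ℝ) (u : List (Fin k)) (p q : ℕ) :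
    ∑ x ∈ wordsOfLength k p, ∑ z ∈ wordsOfLength k q, wordProd M (x ++ (u ++ z)) =
      (∑ i, M i) ^ p * wordProd M u * (∑ i, M i) ^ q := by
  simp_rw [wordProd_append, ← sum_wordProd, Finset.sum_mul, Finset.mul_sum, mul_assoc]

lemma mulVec_apply_nonneg {X : Matrix (Fin d) (Fin d) ℝ} (hX : ∀ a b, 0 ≤ X a b) {v : Fin d → ℝ}
    (hv : ∀ a, 0 ≤ v a) (a : Fin d) : 0 ≤ X.mulVec v a := by
  simp only [Matrix.mulVec, dotProduct]
  exact Finset.sum_nonneg fun b _ => mul_nonneg (hX a b) (hv b)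

lemma sum_mulVec_apply {ι : Type*} (S : Finset ι) (f : ι → Matrix (Fin d) (Fin d) ℝ)
    (v : Fin d → ℝ) (a : Fin d) : ∑ i ∈ S, (f i).mulVec v a = (∑ i ∈ S, f i).mulVec v a := by
  rw [Matrix.sum_mulVec, Finset.sum_apply]

/-- The mass of the words of length `|u| + ℓ` avoiding `u` is a definite factor below the
total mass. -/
lemma exists_avoid_block_le [NeZero d] {M : Fin k → Matrix (Fin d) (Fin d) ℝ}
    (hM : ∀ i a b, 0 ≤ M i a b) {ℓ : ℕ} {η : ℝ} (hη : 0 < η)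
    (hQ : ∀ a b, η ≤ (∑ j ∈ Finset.Icc 1 ℓ, (∑ i, M i) ^ j) a b)
    {v : Fin d → ℝ} (hv : ∀ a, 0 < v a) (hfix : (∑ i, M i).mulVec v = v) :
    ∃ κ : ℝ, 0 < κ ∧ ∀ (u : List (Fin k)) (a : Fin d),
      ∑ w ∈ wordsOfLength k (u.length + ℓ) with ¬ u <:+: w, (wordProd M w).mulVec v a ≤
        Real.exp (-(κ * mnorm (wordProd M u))) * v a := by
  obtain ⟨a₀, ha₀⟩ := Finite.exists_min v
  obtain ⟨a₁, ha₁⟩ := Finite.exists_max v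
  have hℓ : (0 : ℝ) < ℓ := by
    rcases Nat.eq_zero_or_pos ℓ with rfl | h
    · have := hQ 0 0
      simp at this
      linarith
    · exact_mod_cast h
  refine ⟨η * v a₀ / (ℓ * v a₁), div_pos (mul_pos hη (hv _)) (mul_pos hℓ (hv _)), fun u a => ?_⟩
  have hf : ∀ w, 0 ≤ (wordProd M w).mulVec v a := fun w =>
    mulVec_apply_nonneg (wordProd_nonneg hM w) (fun b => (hv b).le) a
  have htot : ∑ w ∈ wordsOfLength k (u.length + ℓ), (wordProd M w).mulVec v a = v a := by
    rw [sum_mulVec_apply, sum_wordProd, pow_mulVec_fixed hfix]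
  set D := ∑ w ∈ wordsOfLength k (u.length + ℓ) with u <:+: w, (wordProd M w).mulVec v a with hD
  have hsplit := Finset.sum_filter_add_sum_filter_not (wordsOfLength k (u.length + ℓ))
    (fun w => u <:+: w) (fun w => (wordProd M w).mulVec v a)
  rw [htot, ← hD] at hsplit
  have hj : ∀ j ∈ Finset.Icc 1 ℓ, ((∑ i, M i) ^ j * wordProd M u).mulVec v a ≤ D := by
    intro j hj
    have hjℓ := (Finset.mem_Icc.1 hj).2
    have := sum_infix_le u j (ℓ - j) hf
    rw [show j + (u.length + (ℓ - j)) = u.length + ℓ by omega, ← hD] at this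
    refine le_trans (le_of_eq ?_) this
    simp_rw [sum_mulVec_apply]
    rw [sum_sum_wordProd, ← Matrix.mulVec_mulVec _ _ ((∑ i, M i) ^ (ℓ - j)),
      pow_mulVec_fixed hfix]
  have hlow : η * v a₀ * mnorm (wordProd M u) ≤ ℓ * D := by
    calc η * v a₀ * mnorm (wordProd M u)
        = ∑ b, ∑ c, η * (wordProd M u b c * v a₀) := by
          rw [mnorm_eq_sum (wordProd_nonneg hM u)]
          simp_rw [Finset.mul_sum]
          refine Finset.sum_congr rfl fun b _ => Finset.sum_congr rfl fun c _ => by ring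
      _ ≤ ∑ b, (∑ j ∈ Finset.Icc 1 ℓ, (∑ i, M i) ^ j) a b * (wordProd M u).mulVec v b := by
          refine Finset.sum_le_sum fun b _ => ?_
          rw [← Finset.mul_sum]
          refine mul_le_mul (hQ a b) (Finset.sum_le_sum fun c _ => ?_) ?_ (hη.le.trans (hQ a b))
          · exact mul_le_mul_of_nonneg_left (ha₀ c) (wordProd_nonneg hM u b c)
          · exact Finset.sum_nonneg fun c _ => mul_nonneg (wordProd_nonneg hM u b c) (hv _).le
      _ = ∑ j ∈ Finset.Icc 1 ℓ, ((∑ i, M i) ^ j * wordProd M u).mulVec v a := by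
          rw [sum_mulVec_apply, ← Finset.sum_mul, ← Matrix.mulVec_mulVec]
          rfl
      _ ≤ ∑ _j ∈ Finset.Icc 1 ℓ, D := Finset.sum_le_sum hj
      _ = ℓ * D := by simp
  set y := η * v a₀ / (ℓ * v a₁) * mnorm (wordProd M u) with hy
  have hy0 : 0 ≤ y := mul_nonneg (div_pos (mul_pos hη (hv _)) (mul_pos hℓ (hv _))).le (mnorm_nonneg _)
  have hyD : y * v a ≤ D := by
    have h1 : y * v a₁ ≤ D := by
      have : y * v a₁ = η * v a₀ * mnorm (wordProd M u) / ℓ := by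
        rw [hy]
        have := (hv a₁).ne'
        field_simp
      rw [this, div_le_iff₀ hℓ, mul_comm D]
      exact hlow
    exact (mul_le_mul_of_nonneg_left (ha₁ a) hy0).trans h1
  have hexp := mul_le_mul_of_nonneg_right (Real.add_one_le_exp (-y)) (hv a).le
  linarith

/-- The mass of the words of length `q (|u| + ℓ)` avoiding `u` decays geometrically in `q`. -/
lemma avoid_mass_le {M : Fin k → Matrix (Fin d) (Fin d) ℝ} (hM : ∀ i a b, 0 ≤ M i a b)
    {v : Fin d → ℝ} (hv : ∀ a, 0 ≤ v a) {u : List (Fin k)} {L : ℕ} {θ : ℝ}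
    (hL : ∀ a, ∑ w ∈ wordsOfLength k L with ¬ u <:+: w, (wordProd M w).mulVec v a ≤ θ * v a)
    (hθ : 0 ≤ θ) (q : ℕ) (a : Fin d) :
    ∑ w ∈ wordsOfLength k (q * L) with ¬ u <:+: w, (wordProd M w).mulVec v a ≤ θ ^ q * v a := by
  induction q generalizing a with
  | zero =>
    rw [Nat.zero_mul, wordsOfLength_zero, Finset.sum_filter, Finset.sum_singleton]
    split_ifs
    · simp [hv a]
    · simp [wordProd_nil]
  | succ q ih =>
    have hv' : ∀ w b, 0 ≤ (wordProd M w).mulVec v b := fun w b =>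
      mulVec_apply_nonneg (wordProd_nonneg hM w) hv b
    calc ∑ w ∈ wordsOfLength k ((q + 1) * L) with ¬ u <:+: w, (wordProd M w).mulVec v a
        ≤ ∑ x ∈ wordsOfLength k (q * L) with ¬ u <:+: x,
            ∑ y ∈ wordsOfLength k L with ¬ u <:+: y, (wordProd M (x ++ y)).mulVec v a := by
          simp_rw [Finset.sum_filter]
          rw [Nat.succ_mul, sum_wordsOfLength_add]
          refine Finset.sum_le_sum fun x _ => ?_
          by_cases hx : u <:+: x
          · rw [if_neg (not_not.2 hx)]
            refine (Finset.sum_eq_zero fun y _ => ?_).le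
            exact if_neg (not_not.2 (hx.trans (List.infix_append' [] x y)))
          · rw [if_pos hx]
            refine Finset.sum_le_sum fun y _ => ?_
            by_cases hy : u <:+: y
            · rw [if_neg (not_not.2 (hy.trans (List.suffix_append x y).isInfix))]
              simp [hy]
            · rw [if_pos hy]
              split_ifs
              exacts [hv' _ _, le_rfl]
      _ ≤ ∑ x ∈ wordsOfLength k (q * L) with ¬ u <:+: x,
            θ * (wordProd M x).mulVec v a := by
          refine Finset.sum_le_sum fun x _ => ?_
          simp_rw [wordProd_append, ← Matrix.mulVec_mulVec]
          calc ∑ y ∈ wordsOfLength k L with ¬ u <:+: y,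
                (wordProd M x).mulVec ((wordProd M y).mulVec v) a
              = ∑ b, wordProd M x a b * ∑ y ∈ wordsOfLength k L with ¬ u <:+: y,
                  (wordProd M y).mulVec v b := by
                simp_rw [Finset.mul_sum]
                rw [Finset.sum_comm]
                rfl
            _ ≤ ∑ b, wordProd M x a b * (θ * v b) := Finset.sum_le_sum fun b _ =>
                mul_le_mul_of_nonneg_left (hL b) (wordProd_nonneg hM x a b)
            _ = θ * (wordProd M x).mulVec v a := by
                simp only [Matrix.mulVec, dotProduct, Finset.mul_sum]
                exact Finset.sum_congr rfl fun b _ => by ring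
      _ ≤ θ * (θ ^ q * v a) := by
          rw [← Finset.mul_sum]
          exact mul_le_mul_of_nonneg_left (ih a) hθ
      _ = θ ^ (q + 1) * v a := by ring

end Perron

section UniformExponent

variable {d k : ℕ}

open Classical in
/-- The words of length `n` with nonzero matrix product. -/
noncomputable def admissibleWords (M : Fin k → Matrix (Fin d) (Fin d) ℝ) (n : ℕ) :
    Finset (List (Fin k)) :=
  {w ∈ wordsOfLength k n | wordProd M w ≠ 0}

lemma mem_admissibleWords {M : Fin k → Matrix (Fin d) (Fin d) ℝ} {n : ℕ} {w : List (Fin k)} :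
    w ∈ admissibleWords M n ↔ w.length = n ∧ wordProd M w ≠ 0 := by
  simp [admissibleWords]

lemma card_admissible_infix_le {M : Fin k → Matrix (Fin d) (Fin d) ℝ} {t C : ℝ} (ht : 0 < t)
    (h3 : ∀ n, ((admissibleWords M n).card : ℝ) * t ^ n ≤ C) (u : List (Fin k)) (n : ℕ) :
    (({w ∈ admissibleWords M n | u <:+: w}).card : ℝ) * t ^ n ≤ (n + 1) * C ^ 2 * t ^ u.length := by
  have hC : 0 ≤ C := le_trans (by positivity) (h3 0)
  rcases lt_or_ge n u.length with hn | hn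
  · have : {w ∈ admissibleWords M n | u <:+: w} = ∅ := by
      refine Finset.filter_eq_empty_iff.2 fun w hw h => ?_
      have := h.length_le
      rw [(mem_admissibleWords.1 hw).1] at this
      omega
    rw [this]
    simp only [Finset.card_empty, Nat.cast_zero, zero_mul]
    positivity
  set r := u.length
  have hsub : {w ∈ admissibleWords M n | u <:+: w} ⊆
      (Finset.range (n - r + 1)).biUnion fun p =>
        (admissibleWords M p ×ˢ admissibleWords M (n - r - p)).image
          fun x => x.1 ++ (u ++ x.2) := by
    intro w hw
    obtain ⟨hw, x, z, rfl⟩ := Finset.mem_filter.1 hw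
    obtain ⟨hlen, hne⟩ := mem_admissibleWords.1 hw
    simp only [List.length_append] at hlen
    simp only [wordProd_append] at hne
    simp only [Finset.mem_biUnion, Finset.mem_range, Finset.mem_image, Finset.mem_product,
      mem_admissibleWords, Prod.exists]
    refine ⟨x.length, by omega, x, z, ⟨⟨rfl, fun h => hne (by simp [h])⟩, by omega,
      fun h => hne (by simp [h])⟩, by simp⟩
  have hcard : (({w ∈ admissibleWords M n | u <:+: w}).card : ℝ) ≤
      ∑ p ∈ Finset.range (n - r + 1),
        ((admissibleWords M p).card : ℝ) * (admissibleWords M (n - r - p)).card := by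
    have := (Finset.card_le_card hsub).trans Finset.card_biUnion_le
    refine (Nat.cast_le (α := ℝ).2 this).trans ?_
    rw [Nat.cast_sum]
    refine Finset.sum_le_sum fun p _ => ?_
    rw [← Nat.cast_mul, ← Finset.card_product]
    exact_mod_cast Finset.card_image_le
  calc _ ≤ (∑ p ∈ Finset.range (n - r + 1),
        ((admissibleWords M p).card : ℝ) * (admissibleWords M (n - r - p)).card) * t ^ n :=
        mul_le_mul_of_nonneg_right hcard (by positivity)
    _ ≤ ∑ _p ∈ Finset.range (n - r + 1), C ^ 2 * t ^ r := by
        rw [Finset.sum_mul]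
        refine Finset.sum_le_sum fun p hp => ?_
        have hp := Finset.mem_range.1 hp
        have e : t ^ n = t ^ p * t ^ (n - r - p) * t ^ r := by
          rw [← pow_add, ← pow_add]
          congr 1
          omega
        rw [e, show ((admissibleWords M p).card : ℝ) * (admissibleWords M (n - r - p)).card *
          (t ^ p * t ^ (n - r - p) * t ^ r) = ((admissibleWords M p).card * t ^ p) *
          ((admissibleWords M (n - r - p)).card * t ^ (n - r - p)) * t ^ r by ring, sq]
        refine mul_le_mul_of_nonneg_right ?_ (by positivity)
        exact mul_le_mul (h3 p) (h3 _) (by positivity) hC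
    _ ≤ (n + 1) * C ^ 2 * t ^ r := by
        rw [Finset.sum_const, Finset.card_range, nsmul_eq_mul, mul_assoc]
        refine mul_le_mul_of_nonneg_right ?_ (by positivity)
        have : n - r + 1 ≤ n + 1 := by omega
        exact_mod_cast this

lemma mulVec_apply_le {X : Matrix (Fin d) (Fin d) ℝ} (hX : ∀ a b, 0 ≤ X a b) {v : Fin d → ℝ}
    {m : ℝ} (hm : 0 ≤ m) (hv : ∀ a, v a ≤ m) (a : Fin d) : X.mulVec v a ≤ mnorm X * m := by
  rw [mnorm_eq_sum hX, Finset.sum_mul]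
  refine le_trans ?_ (Finset.single_le_sum (f := fun a => (∑ b, X a b) * m)
    (fun a _ => mul_nonneg (Finset.sum_nonneg fun b _ => hX a b) hm) (Finset.mem_univ a))
  simp only [Matrix.mulVec, dotProduct, Finset.sum_mul]
  exact Finset.sum_le_sum fun b _ => mul_le_mul_of_nonneg_left (hv b) (hX a b)

lemma mnorm_mul_le_sum_mulVec {X : Matrix (Fin d) (Fin d) ℝ} (hX : ∀ a b, 0 ≤ X a b)
    {v : Fin d → ℝ} {m : ℝ} (hv : ∀ a, m ≤ v a) : mnorm X * m ≤ ∑ a, X.mulVec v a := by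
  rw [mnorm_eq_sum hX, Finset.sum_mul]
  refine Finset.sum_le_sum fun a _ => ?_
  simp only [Matrix.mulVec, dotProduct, Finset.sum_mul]
  exact Finset.sum_le_sum fun b _ => mul_le_mul_of_nonneg_left (hv b) (hX a b)

lemma mnorm_wordProd_le {M : Fin k → Matrix (Fin d) (Fin d) ℝ} (hM : ∀ i a b, 0 ≤ M i a b)
    {C : ℝ} (h2 : ∀ n, mnorm ((∑ i, M i) ^ n) ≤ C) (w : List (Fin k)) :
    mnorm (wordProd M w) ≤ C := by
  refine le_trans ?_ (h2 w.length)
  rw [← sum_mnorm_wordProd hM]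
  exact Finset.single_le_sum (f := fun w => mnorm (wordProd M w)) (fun _ _ => mnorm_nonneg _)
    (mem_wordsOfLength.2 rfl)

/-- Uniform integrability of the normalized masses bounds each of them up to a linear factor. -/
lemma exists_mnorm_le_linear_mul_pow [NeZero d] {M : Fin k → Matrix (Fin d) (Fin d) ℝ}
    (hM : ∀ i a b, 0 ≤ M i a b) {ℓ : ℕ} (hℓ : 1 ≤ ℓ) {κ : ℝ} (hκ : 0 < κ)
    {v : Fin d → ℝ} (hv : ∀ a, 0 < v a) (hfix : (∑ i, M i).mulVec v = v)
    (hav : ∀ (u : List (Fin k)) (a : Fin d),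
      ∑ w ∈ wordsOfLength k (u.length + ℓ) with ¬ u <:+: w, (wordProd M w).mulVec v a ≤
        Real.exp (-(κ * mnorm (wordProd M u))) * v a)
    {t C : ℝ} (ht : 0 < t) (h2 : ∀ n, mnorm ((∑ i, M i) ^ n) ≤ C)
    (h3 : ∀ n, ((admissibleWords M n).card : ℝ) * t ^ n ≤ C)
    (h4 : ∀ ε : ℝ, 0 < ε → ∃ δ : ℝ, 0 < δ ∧ ∀ n, 1 ≤ n → ∀ S ⊆ admissibleWords M n,
      (S.card : ℝ) * t ^ n ≤ δ → ∑ w ∈ S, mnorm (wordProd M w) ≤ ε) :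
    ∃ C₁ : ℝ, 0 < C₁ ∧ ∀ u : List (Fin k),
      mnorm (wordProd M u) ≤ C₁ * (u.length + 1) * t ^ u.length := by
  obtain ⟨a₁, ha₁⟩ := Finite.exists_max v
  have hC : 0 ≤ C := (mnorm_nonneg _).trans (h2 0)
  have hε : 0 < v 0 / (4 * v a₁) := div_pos (hv _) (mul_pos (by norm_num) (hv _))
  obtain ⟨δ, hδ, hS⟩ := h4 _ hε
  have hcoef : 0 < (1 + 2 * κ * C) * (ℓ + 1) * (C ^ 2 + 1) / (δ * κ) := by positivity
  refine ⟨(1 + 2 * κ * C) * (ℓ + 1) * (C ^ 2 + 1) / (δ * κ), hcoef, fun u => ?_⟩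
  rcases (mnorm_nonneg (wordProd M u)).eq_or_lt with h0 | h0
  · rw [← h0]
    positivity
  set m := mnorm (wordProd M u) with hm
  set y := κ * m with hy
  have hy0 : 0 < y := mul_pos hκ h0
  set q := ⌈1 / y⌉₊ with hq
  have hq1 : 1 / y ≤ q := Nat.le_ceil _
  have hq2 : (q : ℝ) < 1 / y + 1 := Nat.ceil_lt_add_one (by positivity)
  have hqpos : 1 ≤ q := Nat.one_le_iff_ne_zero.2 (Nat.ceil_pos.2 (by positivity)).ne'
  set L := u.length + ℓ with hL
  have hn : 1 ≤ q * L := Nat.one_le_iff_ne_zero.2 (Nat.mul_ne_zero (by omega) (by omega))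
  have havoid := avoid_mass_le hM (fun a => (hv a).le) (hav u) (Real.exp_pos _).le q 0
  have hexp : Real.exp (-y) ^ q ≤ 1 / 2 := by
    rw [← Real.exp_nat_mul]
    have h1 : 1 ≤ q * y := by rwa [div_le_iff₀ hy0] at hq1
    calc Real.exp (q * -y) ≤ Real.exp (-1) := Real.exp_le_exp.2 (by linarith)
      _ ≤ 1 / 2 := by
        rw [Real.exp_neg, one_div]
        exact inv_anti₀ (by norm_num) (by linarith [Real.add_one_le_exp (1 : ℝ)])
  have htot : ∑ w ∈ wordsOfLength k (q * L), (wordProd M w).mulVec v 0 = v 0 := by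
    rw [sum_mulVec_apply, sum_wordProd, pow_mulVec_fixed hfix]
  have hsplit := Finset.sum_filter_add_sum_filter_not (wordsOfLength k (q * L))
    (fun w => u <:+: w) (fun w => (wordProd M w).mulVec v 0)
  rw [htot] at hsplit
  have hhalf : Real.exp (-y) ^ q * v 0 ≤ 1 / 2 * v 0 :=
    mul_le_mul_of_nonneg_right hexp (hv 0).le
  have hmass : ∑ w ∈ wordsOfLength k (q * L) with u <:+: w, (wordProd M w).mulVec v 0 ≤
      (∑ w ∈ admissibleWords M (q * L) with u <:+: w, mnorm (wordProd M w)) * v a₁ := by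
    rw [Finset.sum_mul]
    calc ∑ w ∈ wordsOfLength k (q * L) with u <:+: w, (wordProd M w).mulVec v 0
        = ∑ w ∈ admissibleWords M (q * L) with u <:+: w, (wordProd M w).mulVec v 0 := by
          symm
          refine Finset.sum_subset (fun w hw => ?_) fun w hw hw' => ?_
          · simp only [Finset.mem_filter, mem_admissibleWords, mem_wordsOfLength] at hw ⊢
            exact ⟨hw.1.1, hw.2⟩
          · simp only [Finset.mem_filter, mem_admissibleWords, mem_wordsOfLength] at hw hw'
            have : wordProd M w = 0 := by
              by_contra h
              exact hw' ⟨⟨hw.1, h⟩, hw.2⟩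
            simp [this]
      _ ≤ _ := Finset.sum_le_sum fun w _ =>
          mulVec_apply_le (wordProd_nonneg hM w) (hv _).le ha₁ 0
  have hbig : δ < (({w ∈ admissibleWords M (q * L) | u <:+: w}).card : ℝ) * t ^ (q * L) := by
    by_contra hcon
    have h5 := hS _ hn _ (Finset.filter_subset _ _) (not_lt.1 hcon)
    have h6 := mul_le_mul_of_nonneg_right h5 (hv a₁).le
    have h7 : v 0 / (4 * v a₁) * v a₁ = v 0 / 4 := by
      have := (hv a₁).ne'
      field_simp
    have := hv 0
    linarith
  have hcard := hbig.trans_le (card_admissible_infix_le ht h3 u (q * L))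
  have hmC : m ≤ C := mnorm_wordProd_le hM h2 u
  have hL1 : (0 : ℝ) ≤ L := Nat.cast_nonneg _
  have hyn : y * ((q * L : ℕ) + 1 : ℝ) ≤ (1 + 2 * κ * C) * (L + 1) := by
    have e1 : y * q ≤ 1 + y := by
      calc y * q ≤ y * (1 / y + 1) := mul_le_mul_of_nonneg_left hq2.le hy0.le
        _ = 1 + y := by field_simp
    have e2 : y ≤ κ * C := mul_le_mul_of_nonneg_left hmC hκ.le
    push_cast
    nlinarith [mul_le_mul_of_nonneg_right e1 hL1, mul_le_mul_of_nonneg_right e2 hL1]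
  have hLu : ((L : ℝ) + 1) ≤ (ℓ + 1) * (u.length + 1) := by
    rw [hL]
    push_cast
    nlinarith [mul_nonneg (Nat.cast_nonneg (α := ℝ) ℓ) (Nat.cast_nonneg (α := ℝ) u.length)]
  have hfin : y * δ ≤ (1 + 2 * κ * C) * ((ℓ + 1) * (u.length + 1)) * (C ^ 2 + 1) * t ^ u.length := by
    calc y * δ ≤ y * (((q * L : ℕ) + 1 : ℝ) * C ^ 2 * t ^ u.length) :=
          mul_le_mul_of_nonneg_left hcard.le hy0.le
      _ = y * ((q * L : ℕ) + 1 : ℝ) * C ^ 2 * t ^ u.length := by ring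
      _ ≤ (1 + 2 * κ * C) * ((ℓ + 1) * (u.length + 1)) * (C ^ 2 + 1) * t ^ u.length := by
          refine mul_le_mul_of_nonneg_right ?_ (by positivity)
          refine mul_le_mul (hyn.trans (mul_le_mul_of_nonneg_left hLu (by positivity)))
            (by linarith) (by positivity) (by positivity)
  rw [div_mul_eq_mul_div, div_mul_eq_mul_div, le_div_iff₀ (mul_pos hδ hκ)]
  calc m * (δ * κ) = y * δ := by rw [hy]; ring
    _ ≤ _ := hfin
    _ = _ := by ring

lemma le_one_of_pow_le_linear {z K : ℝ} (hK : 0 < K)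
    (h : ∀ n : ℕ, z ^ (n + 1) ≤ K * ((n : ℝ) + 1)) : z ≤ 1 := by
  by_contra! hz
  have ht := tendsto_pow_const_div_const_pow_of_one_lt 1 hz
  obtain ⟨n, hn, h1⟩ := ((ht.eventually (gt_mem_nhds (inv_pos.2 hK))).and
    (eventually_ge_atTop 1)).exists
  obtain ⟨n, rfl⟩ := Nat.exists_eq_succ_of_ne_zero (Nat.one_le_iff_ne_zero.1 h1)
  have hzp : 0 < z ^ (n + 1) := by positivity
  rw [pow_one, Nat.succ_eq_add_one, div_lt_iff₀ hzp, lt_inv_mul_iff₀ hK] at hn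
  have := h n
  push_cast at hn
  linarith

/-- Words can be connected with a uniformly bounded loss of norm. -/
lemma exists_connecting_word {M : Fin k → Matrix (Fin d) (Fin d) ℝ}
    (hM : ∀ i a b, 0 ≤ M i a b) {ℓ : ℕ} {η : ℝ} (hη : 0 < η)
    (hQ : ∀ a b, η ≤ (∑ j ∈ Finset.Icc 1 ℓ, (∑ i, M i) ^ j) a b) :
    ∃ δ : ℝ, 0 < δ ∧ ∀ w u : List (Fin k), ∃ x : List (Fin k), x.length ≤ ℓ ∧
      δ * mnorm (wordProd M w) * mnorm (wordProd M u) ≤ mnorm (wordProd M (w ++ (x ++ u))) := by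
  set D : ℝ := ∑ j ∈ Finset.Icc 1 ℓ, ((wordsOfLength k j).card : ℝ) with hD
  have hD0 : 0 ≤ D := Finset.sum_nonneg fun _ _ => Nat.cast_nonneg _
  have hD1 : 0 < D + 1 := by linarith
  refine ⟨η / (D + 1), div_pos hη hD1, fun w u => ?_⟩
  set X := mnorm (wordProd M w)
  set Y := mnorm (wordProd M u)
  by_contra! hcon
  have hXY : 0 < η / (D + 1) * X * Y :=
    (mnorm_nonneg _).trans_lt (hcon [] (Nat.zero_le ℓ))
  have hsum : η * X * Y ≤ D * (η / (D + 1) * X * Y) := by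
    refine (le_mnorm_mul_mul hη.le (wordProd_nonneg hM w) hQ (wordProd_nonneg hM u)).trans ?_
    have e : wordProd M w * (∑ j ∈ Finset.Icc 1 ℓ, (∑ i, M i) ^ j) * wordProd M u =
        ∑ j ∈ Finset.Icc 1 ℓ, ∑ x ∈ wordsOfLength k j, wordProd M (w ++ (x ++ u)) := by
      simp_rw [wordProd_append, ← sum_wordProd, Finset.mul_sum, Finset.sum_mul, mul_assoc]
    rw [e, mnorm_sum _ _ fun j _ a b => ?_, hD, Finset.sum_mul]
    · refine Finset.sum_le_sum fun j hj => ?_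
      rw [mnorm_sum _ _ fun x _ => wordProd_nonneg hM _, ← nsmul_eq_mul]
      refine Finset.sum_le_card_nsmul _ _ _ fun x hx => (hcon x ?_).le
      rw [mem_wordsOfLength.1 hx]
      exact (Finset.mem_Icc.1 hj).2
    · rw [Matrix.sum_apply]
      exact Finset.sum_nonneg fun x _ => wordProd_nonneg hM _ a b
  have e : η * X * Y = (D + 1) * (η / (D + 1) * X * Y) := by
    rw [← mul_assoc, ← mul_assoc, mul_div_cancel₀ _ hD1.ne']
  rw [e] at hsum
  linarith

/-- A linear loss in the norm bounds can be removed using approximate supermultiplicativity. -/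
lemma mnorm_le_of_le_linear {M : Fin k → Matrix (Fin d) (Fin d) ℝ} {t C₁ δ : ℝ} {ℓ : ℕ}
    (ht : 0 < t) (ht1 : t ≤ 1) (hC₁ : 0 < C₁) (hδ : 0 < δ)
    (hlin : ∀ u : List (Fin k), mnorm (wordProd M u) ≤ C₁ * (u.length + 1) * t ^ u.length)
    (hcon : ∀ w u : List (Fin k), ∃ x : List (Fin k), x.length ≤ ℓ ∧
      δ * mnorm (wordProd M w) * mnorm (wordProd M u) ≤ mnorm (wordProd M (w ++ (x ++ u))))
    (u : List (Fin k)) : mnorm (wordProd M u) ≤ δ⁻¹ * t ^ u.length := by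
  set m := mnorm (wordProd M u) with hm
  have hm0 : 0 ≤ m := mnorm_nonneg _
  set r := u.length with hr
  have hiter : ∀ q : ℕ, ∃ w : List (Fin k), (q + 1) * r ≤ w.length ∧
      w.length ≤ (q + 1) * (r + ℓ) ∧ δ ^ q * m ^ (q + 1) ≤ mnorm (wordProd M w) := by
    intro q
    induction q with
    | zero => exact ⟨u, by omega, by omega, by simp [hm]⟩
    | succ q ih =>
      obtain ⟨w, h1, h2, h3⟩ := ih
      obtain ⟨x, hx, h4⟩ := hcon w u
      refine ⟨w ++ (x ++ u), ?_, ?_, ?_⟩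
      · simp only [List.length_append]
        nlinarith
      · simp only [List.length_append]
        nlinarith
      · refine le_trans ?_ h4
        calc δ ^ (q + 1) * m ^ (q + 1 + 1) = δ * (δ ^ q * m ^ (q + 1)) * m := by ring
          _ ≤ _ := mul_le_mul_of_nonneg_right (mul_le_mul_of_nonneg_left h3 hδ.le) hm0
  have htr : 0 < t ^ r := by positivity
  have hz : δ * m / t ^ r ≤ 1 := by
    refine le_one_of_pow_le_linear (K := δ * C₁ * (r + ℓ + 1)) (by positivity) fun q => ?_
    obtain ⟨w, h1, h2, h3⟩ := hiter q
    rw [div_pow, div_le_iff₀ (by positivity), ← pow_mul]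
    have h2' : (w.length : ℝ) ≤ (q + 1) * (r + ℓ) := by exact_mod_cast h2
    calc (δ * m) ^ (q + 1) = δ * (δ ^ q * m ^ (q + 1)) := by ring
      _ ≤ δ * (C₁ * (w.length + 1) * t ^ w.length) :=
          mul_le_mul_of_nonneg_left (h3.trans (hlin w)) hδ.le
      _ ≤ δ * (C₁ * (((q : ℝ) + 1) * (r + ℓ + 1)) * t ^ (r * (q + 1))) := by
          refine mul_le_mul_of_nonneg_left ?_ hδ.le
          refine mul_le_mul (mul_le_mul_of_nonneg_left ?_ hC₁.le)
            (pow_le_pow_of_le_one ht.le ht1 (by rw [mul_comm]; exact h1)) (by positivity)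
            (by positivity)
          have : (0 : ℝ) ≤ q := Nat.cast_nonneg q
          linarith
      _ = _ := by ring
  rw [div_le_one htr] at hz
  rwa [le_inv_mul_iff₀ hδ]

/-- A uniform upper bound on the normalized norms, together with a lower bound on the total
mass, gives a uniform lower bound for the nonzero norms. -/
lemma exists_le_mnorm [NeZero d] {M : Fin k → Matrix (Fin d) (Fin d) ℝ}
    (hM : ∀ i a b, 0 ≤ M i a b) {ℓ : ℕ} {κ : ℝ} (hκ : 0 < κ)
    {v : Fin d → ℝ} (hv : ∀ a, 0 < v a)
    (hav : ∀ (u : List (Fin k)) (a : Fin d),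
      ∑ w ∈ wordsOfLength k (u.length + ℓ) with ¬ u <:+: w, (wordProd M w).mulVec v a ≤
        Real.exp (-(κ * mnorm (wordProd M u))) * v a)
    {t c C C₂ : ℝ} (ht : 0 < t) (hc : 0 < c) (hC : 0 < C) (hC₂ : 0 < C₂)
    (h1 : ∀ n, c ≤ mnorm ((∑ i, M i) ^ n))
    (h3 : ∀ n, ((admissibleWords M n).card : ℝ) * t ^ n ≤ C)
    (hup : ∀ u : List (Fin k), mnorm (wordProd M u) ≤ C₂ * t ^ u.length)
    (u : List (Fin k)) (hu : wordProd M u ≠ 0) :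
    c / (2 * C * C₂ ^ 2) * t ^ u.length ≤ mnorm (wordProd M u) := by
  obtain ⟨a₀, ha₀⟩ := Finite.exists_min v
  set m := mnorm (wordProd M u) with hm
  have hm0 : 0 < m := mnorm_pos_iff.2 hu
  have hV : 0 < ∑ a, v a := Finset.sum_pos (fun a _ => hv a) Finset.univ_nonempty
  set L := u.length + ℓ
  obtain ⟨q, hq⟩ := exists_pow_lt_of_lt_one
    (show 0 < c * v a₀ / (2 * ∑ a, v a) from div_pos (mul_pos hc (hv _)) (by positivity))
    (show Real.exp (-(κ * m)) < 1 from Real.exp_lt_one_iff.2 (neg_neg_of_pos (mul_pos hκ hm0)))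
  rw [lt_div_iff₀ (by positivity)] at hq
  have havoid : (∑ w ∈ wordsOfLength k (q * L) with ¬ u <:+: w, mnorm (wordProd M w)) * v a₀ ≤
      Real.exp (-(κ * m)) ^ q * ∑ a, v a := by
    rw [Finset.sum_mul, Finset.mul_sum]
    refine (Finset.sum_le_sum fun w _ =>
      mnorm_mul_le_sum_mulVec (wordProd_nonneg hM w) ha₀).trans ?_
    rw [Finset.sum_comm]
    exact Finset.sum_le_sum fun a _ =>
      avoid_mass_le hM (fun a => (hv a).le) (hav u) (Real.exp_pos _).le q a
  have hav2 : ∑ w ∈ wordsOfLength k (q * L) with ¬ u <:+: w, mnorm (wordProd M w) ≤ c / 2 := by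
    refine le_of_mul_le_mul_right ?_ (hv a₀)
    linarith
  have hsplit := Finset.sum_filter_add_sum_filter_not (wordsOfLength k (q * L))
    (fun w => u <:+: w) (fun w => mnorm (wordProd M w))
  rw [sum_mnorm_wordProd hM] at hsplit
  have hcont : (∑ w ∈ wordsOfLength k (q * L) with u <:+: w, mnorm (wordProd M w)) *
      t ^ u.length ≤ C * (C₂ ^ 2 * m) := by
    have e1 : ∑ w ∈ wordsOfLength k (q * L) with u <:+: w, mnorm (wordProd M w) ≤
        ∑ w ∈ admissibleWords M (q * L) with u <:+: w, mnorm (wordProd M w) := by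
      refine (Finset.sum_subset (fun w hw => ?_) fun w hw hw' => ?_).ge
      · simp only [Finset.mem_filter, mem_admissibleWords, mem_wordsOfLength] at hw ⊢
        exact ⟨hw.1.1, hw.2⟩
      · simp only [Finset.mem_filter, mem_admissibleWords, mem_wordsOfLength] at hw hw'
        have : wordProd M w = 0 := by
          by_contra h
          exact hw' ⟨⟨hw.1, h⟩, hw.2⟩
        exact mnorm_eq_zero_iff.2 this
    have e2 : ∀ w ∈ admissibleWords M (q * L), u <:+: w →
        mnorm (wordProd M w) * t ^ u.length ≤ C₂ ^ 2 * m * t ^ (q * L) := by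
      rintro w hw ⟨x, z, rfl⟩
      have hlen := (mem_admissibleWords.1 hw).1
      simp only [List.length_append] at hlen
      have hn : t ^ (q * L) = t ^ x.length * t ^ z.length * t ^ u.length := by
        rw [← hlen]; ring
      rw [wordProd_append, wordProd_append, hn]
      calc mnorm (wordProd M x * wordProd M u * wordProd M z) * t ^ u.length
          ≤ (C₂ * t ^ x.length) * m * (C₂ * t ^ z.length) * t ^ u.length := by
            refine mul_le_mul_of_nonneg_right ?_ (by positivity)
            refine (mnorm_mul_le _ _).trans (mul_le_mul ((mnorm_mul_le _ _).trans ?_) (hup z)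
              (mnorm_nonneg _) (by positivity))
            exact mul_le_mul_of_nonneg_right (hup x) hm0.le
        _ = _ := by ring
    calc _ ≤ (∑ w ∈ admissibleWords M (q * L) with u <:+: w, mnorm (wordProd M w)) *
          t ^ u.length := mul_le_mul_of_nonneg_right e1 (by positivity)
      _ ≤ ∑ w ∈ admissibleWords M (q * L) with u <:+: w, C₂ ^ 2 * m * t ^ (q * L) := by
          rw [Finset.sum_mul]
          exact Finset.sum_le_sum fun w hw =>
            e2 w (Finset.mem_filter.1 hw).1 (Finset.mem_filter.1 hw).2
      _ ≤ ∑ w ∈ admissibleWords M (q * L), C₂ ^ 2 * m * t ^ (q * L) :=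
          Finset.sum_le_sum_of_subset_of_nonneg (Finset.filter_subset _ _)
            fun _ _ _ => by positivity
      _ = ((admissibleWords M (q * L)).card * t ^ (q * L)) * (C₂ ^ 2 * m) := by
          rw [Finset.sum_const, nsmul_eq_mul]; ring
      _ ≤ _ := mul_le_mul_of_nonneg_right (h3 _) (by positivity)
  have hge : c / 2 ≤ ∑ w ∈ wordsOfLength k (q * L) with u <:+: w, mnorm (wordProd M w) := by
    linarith [h1 (q * L)]
  have := (mul_le_mul_of_nonneg_right hge (pow_pos ht u.length).le).trans hcont
  rw [div_mul_eq_mul_div, div_le_iff₀ (by positivity)]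
  linarith

/-- If the normalized norms of the products along words are uniformly integrable with respect to
the counting measures, then the tuple has a uniform Lyapunov exponent modulo 0. -/
theorem hasULE_of_uniformIntegrable [NeZero d] {M : Fin k → Matrix (Fin d) (Fin d) ℝ}
    (hM : PosIrred M) {t c C : ℝ} (ht : 0 < t) (ht1 : t ≤ 1) (hc : 0 < c)
    (h1 : ∀ n, c ≤ mnorm ((∑ i, M i) ^ n)) (h2 : ∀ n, mnorm ((∑ i, M i) ^ n) ≤ C)
    (h3 : ∀ n, ((admissibleWords M n).card : ℝ) * t ^ n ≤ C)
    (h4 : ∀ ε : ℝ, 0 < ε → ∃ δ : ℝ, 0 < δ ∧ ∀ n, 1 ≤ n → ∀ S ⊆ admissibleWords M n,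
      (S.card : ℝ) * t ^ n ≤ δ → ∑ w ∈ S, mnorm (wordProd M w) ≤ ε) : HasULE M := by
  obtain ⟨hM0, ℓ, hℓ, hQ⟩ := hM
  obtain ⟨η, hη, hηQ⟩ : ∃ η : ℝ, 0 < η ∧
      ∀ a b, η ≤ (∑ j ∈ Finset.Icc 1 ℓ, (∑ i, M i) ^ j) a b := by
    obtain ⟨⟨a, b⟩, hab⟩ := Finite.exists_min
      fun x : Fin d × Fin d => (∑ j ∈ Finset.Icc 1 ℓ, (∑ i, M i) ^ j) x.1 x.2
    exact ⟨_, hQ a b, fun a b => hab (a, b)⟩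
  have hB0 : ∀ a b, 0 ≤ (∑ i, M i) a b := fun a b => by
    rw [Matrix.sum_apply]
    exact Finset.sum_nonneg fun i _ => hM0 i a b
  obtain ⟨v, hv, hfix⟩ := exists_pos_fixed_vector hB0 hQ hc h1 h2
  obtain ⟨κ, hκ, hav⟩ := exists_avoid_block_le hM0 hη hηQ hv hfix
  obtain ⟨C₁, hC₁, hlin⟩ := exists_mnorm_le_linear_mul_pow hM0 hℓ hκ hv hfix hav ht h2 h3 h4
  obtain ⟨δ, hδ, hcon⟩ := exists_connecting_word hM0 hη hηQ
  have hup := mnorm_le_of_le_linear ht ht1 hC₁ hδ hlin hcon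
  have hC : 0 < C := hc.trans_le ((h1 0).trans (h2 0))
  have hδ' : 0 < δ⁻¹ := inv_pos.2 hδ
  have hlow := exists_le_mnorm hM0 hκ hv hav ht hc hC hδ' h1 h3 hup
  set g := c / (2 * C * δ⁻¹ ^ 2) with hg
  have hg0 : 0 < g := by positivity
  refine ⟨δ⁻¹ + g⁻¹, by positivity, Real.log t, fun w _ => ?_⟩
  have he : Real.exp (Real.log t * w.length) = t ^ w.length := by
    rw [mul_comm, Real.exp_nat_mul, Real.exp_log ht]
  rw [he]
  have htw : 0 < t ^ w.length := by positivity
  refine or_iff_not_imp_left.2 fun hw => ⟨le_trans ?_ (hlow w hw), (hup w).trans ?_⟩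
  · refine mul_le_mul_of_nonneg_right ?_ htw.le
    refine inv_le_of_inv_le₀ hg0 ?_
    linarith
  · refine mul_le_mul_of_nonneg_right ?_ htw.le
    have := inv_pos.2 hg0
    linarith

end UniformExponent

section Frostman

open scoped ENNReal

/-- A mass distribution principle along a geometric sequence of scales. -/
lemma absolutelyContinuous_hausdorffMeasure {ν : Measure ℝ} {ρ s C : ℝ} (hρ0 : 0 < ρ)
    (hρ1 : ρ < 1) (hs : 0 ≤ s) (hC : 0 < C) (hatom : ∀ x, ν {x} = 0)
    (h : ∀ (x : ℝ) (n : ℕ), 1 ≤ n →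
      ν (Set.Icc (x - ρ ^ n) (x + ρ ^ n)) ≤ ENNReal.ofReal (C * (ρ ^ s) ^ n)) :
    ν ≪ μH[s] := by
  have hK : 0 < C * (ρ ^ s)⁻¹ := by positivity
  set κ : ℝ≥0∞ := ENNReal.ofReal (C * (ρ ^ s)⁻¹) with hκ
  have hκ0 : κ ≠ 0 := (ENNReal.ofReal_pos.2 hK).ne'
  have hκt : κ ≠ ⊤ := ENNReal.ofReal_ne_top
  have hle : κ⁻¹ • ν ≤ μH[s] := by
    refine Measure.le_hausdorffMeasure s _ (ENNReal.ofReal ρ) (ENNReal.ofReal_pos.2 hρ0)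
      fun E hE => ?_
    rw [Measure.smul_apply, smul_eq_mul, ENNReal.inv_mul_le_iff hκ0 hκt]
    rcases E.subsingleton_or_nontrivial with hsub | hnt
    · rcases hsub.eq_empty_or_singleton with rfl | ⟨x, rfl⟩
      · simp
      · rw [hatom]
        exact zero_le
    have hfin : Metric.ediam E ≠ ⊤ := ne_top_of_le_ne_top ENNReal.ofReal_ne_top hE
    have hbdd : Bornology.IsBounded E := Metric.isBounded_iff_ediam_ne_top.2 hfin
    have hd0 : 0 < Metric.diam E := Metric.diam_pos hnt hbdd
    have hdρ : Metric.diam E ≤ ρ := ENNReal.toReal_le_of_le_ofReal hρ0.le hE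
    obtain ⟨n, hn1, hn2⟩ := exists_nat_pow_near_of_lt_one hd0 (hdρ.trans hρ1.le) hρ0 hρ1
    have hn : 1 ≤ n := by
      rcases Nat.eq_zero_or_pos n with rfl | hn
      · simp only [zero_add, pow_one] at hn1
        linarith
      · exact hn
    obtain ⟨x, hx⟩ := hnt.nonempty
    have hsub : E ⊆ Set.Icc (x - ρ ^ n) (x + ρ ^ n) := fun y hy => by
      have := (Metric.dist_le_diam_of_mem hbdd hy hx).trans hn2
      rw [Real.dist_eq, abs_le] at this
      constructor <;> linarith [this.1, this.2]
    refine (measure_mono hsub).trans ((h x n hn).trans ?_)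
    have e : Metric.ediam E ^ s = ENNReal.ofReal (Metric.diam E ^ s) := by
      rw [← ENNReal.ofReal_rpow_of_nonneg hd0.le hs, Metric.diam, ENNReal.ofReal_toReal hfin]
    rw [e, hκ, ← ENNReal.ofReal_mul hK.le]
    refine ENNReal.ofReal_le_ofReal ?_
    have h1 : (ρ ^ s) ^ (n + 1) ≤ Metric.diam E ^ s := by
      rw [← Real.rpow_natCast, ← Real.rpow_mul hρ0.le, mul_comm s, Real.rpow_mul hρ0.le,
        Real.rpow_natCast]
      exact Real.rpow_le_rpow (by positivity) hn1.le hs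
    have hρs : 0 < ρ ^ s := by positivity
    calc C * (ρ ^ s) ^ n = C * (ρ ^ s)⁻¹ * (ρ ^ s) ^ (n + 1) := by
          rw [pow_succ]
          field_simp
      _ ≤ _ := mul_le_mul_of_nonneg_left h1 hK.le
  refine Measure.AbsolutelyContinuous.mk fun E _ hE => ?_
  have := (hle E).trans hE.le
  rw [Measure.smul_apply, smul_eq_mul, nonpos_iff_eq_zero, mul_eq_zero] at this
  exact this.resolve_left (ENNReal.inv_ne_zero.2 hκt)

end Frostman

section SelfSimilar

variable {m : ℕ} {ρ : ℝ} {b p : Fin m → ℝ} {K : Set ℝ} {μ : Measure ℝ}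

/-- A self-similar probability measure is carried by the attractor. -/
lemma measure_compl_attractor [IsProbabilityMeasure μ] (hρ0 : 0 < ρ) (hρ1 : ρ < 1)
    (hKne : K.Nonempty) (hKcpt : IsCompact K) (hK : K = ⋃ j, (fun x => ρ * x + b j) '' K)
    (hp : ∀ j, 0 < p j) (hpsum : ∑ j, p j = 1)
    (hself : μ = ∑ j, ENNReal.ofReal (p j) • μ.map fun x => ρ * x + b j) : μ Kᶜ = 0 := by
  set U : ℝ → Set ℝ := fun δ => {x | δ < Metric.infDist x K} with hU
  have hUopen : ∀ δ, IsOpen (U δ) := fun δ =>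
    isOpen_lt continuous_const (Metric.continuous_infDist_pt K)
  have hpre : ∀ δ j, (fun x => ρ * x + b j) ⁻¹' U δ ⊆ U (δ / ρ) := by
    intro δ j x hx
    obtain ⟨y, hy, hxy⟩ := hKcpt.exists_infDist_eq_dist hKne x
    have hyK : ρ * y + b j ∈ K := by
      rw [hK]
      exact Set.mem_iUnion.2 ⟨j, y, hy, rfl⟩
    have h1 : δ < dist (ρ * x + b j) (ρ * y + b j) :=
      lt_of_lt_of_le hx (Metric.infDist_le_dist_of_mem hyK)
    simp only [hU, Set.mem_ofPred_eq, hxy]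
    rw [div_lt_iff₀ hρ0]
    rw [Real.dist_eq] at h1 ⊢
    rwa [show ρ * x + b j - (ρ * y + b j) = (x - y) * ρ by ring, abs_mul, abs_of_pos hρ0] at h1
  have hstep : ∀ δ, μ (U δ) ≤ μ (U (δ / ρ)) := by
    intro δ
    calc μ (U δ) = ∑ j, ENNReal.ofReal (p j) * μ ((fun x => ρ * x + b j) ⁻¹' U δ) := by
          have := congrArg (fun ν : Measure ℝ => ν (U δ)) hself
          simp only [Measure.finsetSum_apply, Measure.smul_apply, smul_eq_mul] at this
          rw [this]
          refine Finset.sum_congr rfl fun j _ => ?_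
          rw [Measure.map_apply (by fun_prop) (hUopen δ).measurableSet]
      _ ≤ ∑ j, ENNReal.ofReal (p j) * μ (U (δ / ρ)) :=
          Finset.sum_le_sum fun j _ => mul_le_mul_right (measure_mono (hpre δ j)) _
      _ = μ (U (δ / ρ)) := by
          rw [← Finset.sum_mul, ← ENNReal.ofReal_sum_of_nonneg fun j _ => (hp j).le, hpsum]
          simp
  have hiter : ∀ δ (n : ℕ), μ (U δ) ≤ μ (U (δ / ρ ^ n)) := by
    intro δ n
    induction n with
    | zero => simp
    | succ n ih =>
      refine (ih.trans (hstep _)).trans_eq ?_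
      rw [div_div, pow_succ]
  have hzero : ∀ δ, 0 < δ → μ (U δ) = 0 := by
    intro δ hδ
    have hanti : Antitone fun n : ℕ => U (δ / ρ ^ n) := by
      intro i j hij x hx
      have hx' : δ / ρ ^ j < Metric.infDist x K := hx
      refine lt_of_le_of_lt (b := δ / ρ ^ j) ?_ hx'
      exact div_le_div_of_nonneg_left hδ.le (by positivity) (pow_le_pow_of_le_one hρ0.le hρ1.le hij)
    have hlim := tendsto_measure_iInter_atTop (μ := μ)
      (fun n => (hUopen (δ / ρ ^ n)).measurableSet.nullMeasurableSet) hanti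
      ⟨0, measure_ne_top μ _⟩
    have hempty : ⋂ n : ℕ, U (δ / ρ ^ n) = ∅ := by
      refine Set.eq_empty_iff_forall_notMem.2 fun x hx => ?_
      obtain ⟨n, hn⟩ := exists_pow_lt_of_lt_one
        (show 0 < δ / (Metric.infDist x K + 1) from
          div_pos hδ (by linarith [Metric.infDist_nonneg (x := x) (s := K)])) hρ1
      have h1 := Set.mem_iInter.1 hx n
      simp only [hU, Set.mem_ofPred_eq] at h1
      have hI := Metric.infDist_nonneg (x := x) (s := K)
      rw [lt_div_iff₀ (by linarith)] at hn
      have hρn : 0 < ρ ^ n := by positivity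
      rw [div_lt_iff₀ hρn] at h1
      nlinarith
    rw [hempty, measure_empty] at hlim
    exact le_antisymm (ge_of_tendsto' hlim fun n => hiter δ n) zero_le
  have hsub : Kᶜ ⊆ ⋃ n : ℕ, U (1 / ((n : ℝ) + 1)) := by
    intro x hx
    have : 0 < Metric.infDist x K := (hKcpt.isClosed.notMem_iff_infDist_pos hKne).1 hx
    obtain ⟨n, hn⟩ := exists_nat_one_div_lt this
    exact Set.mem_iUnion.2 ⟨n, hn⟩
  exact measure_mono_null hsub (measure_iUnion_null fun n => hzero _ (by positivity))

/-- Every point of the attractor lies in small cylinders whose pushed-forward measure is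
absolutely continuous. -/
lemma exists_cylinder (hK : K = ⋃ j, (fun x => ρ * x + b j) '' K) (hp : ∀ j, 0 < p j)
    (hself : μ = ∑ j, ENNReal.ofReal (p j) • μ.map fun x => ρ * x + b j) (n : ℕ) :
    ∀ x ∈ K, ∃ a : ℝ, (∃ y ∈ K, x = ρ ^ n * y + a) ∧ μ.map (fun z => ρ ^ n * z + a) ≪ μ := by
  induction n with
  | zero =>
    intro x hx
    refine ⟨0, ⟨x, hx, by simp⟩, ?_⟩
    have : (fun z : ℝ => ρ ^ 0 * z + 0) = id := by ext; simp
    rw [this, Measure.map_id]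
  | succ n ih =>
    intro x hx
    rw [hK] at hx
    obtain ⟨j, x', hx', rfl⟩ := Set.mem_iUnion.1 hx
    obtain ⟨a, ⟨y, hy, rfl⟩, hac⟩ := ih x' hx'
    refine ⟨ρ * a + b j, ⟨y, hy, by ring⟩, ?_⟩
    have hcomp : (fun z : ℝ => ρ ^ (n + 1) * z + (ρ * a + b j)) =
        (fun z => ρ * z + b j) ∘ fun z => ρ ^ n * z + a := by
      ext z
      simp only [Function.comp]
      ring
    rw [hcomp, ← Measure.map_map (by fun_prop) (by fun_prop)]
    refine (hac.map (f := fun z => ρ * z + b j) (by fun_prop)).trans ?_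
    refine Measure.AbsolutelyContinuous.mk fun E hE h0 => ?_
    have := congrArg (fun ν : Measure ℝ => ν E) hself
    simp only [Measure.finsetSum_apply, Measure.smul_apply, smul_eq_mul] at this
    rw [h0] at this
    have h1 := (Finset.sum_eq_zero_iff.1 this.symm) j (Finset.mem_univ j)
    exact (mul_eq_zero.1 h1).resolve_left (ENNReal.ofReal_pos.2 (hp j)).ne'

/-- A self-similar measure absolutely continuous with respect to Hausdorff measure on an interval
of positive mass is absolutely continuous on the whole attractor. -/
lemma absolutelyContinuous_of_restrict [IsProbabilityMeasure μ] (hρ0 : 0 < ρ) (hρ1 : ρ < 1)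
    (hKne : K.Nonempty) (hKcpt : IsCompact K) (hK : K = ⋃ j, (fun x => ρ * x + b j) '' K)
    (hp : ∀ j, 0 < p j) (hpsum : ∑ j, p j = 1)
    (hself : μ = ∑ j, ENNReal.ofReal (p j) • μ.map fun x => ρ * x + b j)
    {s : ℝ} (hs : 0 ≤ s) {l r : ℝ} (hpos : μ (Set.Ioo l r) ≠ 0)
    (hac : μ.restrict (Set.Icc l r) ≪ μH[s]) : μ ≪ (μH[s]).restrict K := by
  have hcompl := measure_compl_attractor hρ0 hρ1 hKne hKcpt hK hp hpsum hself
  obtain ⟨x, hxI, hxK⟩ : (Set.Ioo l r ∩ K).Nonempty := by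
    by_contra hne
    rw [Set.not_nonempty_iff_eq_empty] at hne
    have hsub : Set.Ioo l r ⊆ Kᶜ := (Set.disjoint_iff_inter_eq_empty.2 hne).subset_compl_right
    exact hpos (measure_mono_null hsub hcompl)
  set g := min (x - l) (r - x) with hg
  have hg0 : 0 < g := lt_min (by linarith [hxI.1]) (by linarith [hxI.2])
  obtain ⟨n, hn⟩ := exists_pow_lt_of_lt_one
    (show 0 < g / (Metric.diam K + 1) from
      div_pos hg0 (by linarith [Metric.diam_nonneg (s := K)])) hρ1
  rw [lt_div_iff₀ (by linarith [Metric.diam_nonneg (s := K)])] at hn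
  obtain ⟨a, ⟨y, hy, hxy⟩, hmap⟩ := exists_cylinder hK hp hself n x hxK
  have hρn : 0 < ρ ^ n := by positivity
  have himg : (fun z => ρ ^ n * z + a) '' K ⊆ Set.Icc l r := by
    rintro _ ⟨z, hz, rfl⟩
    have hd := Metric.dist_le_diam_of_mem hKcpt.isBounded hz hy
    rw [Real.dist_eq] at hd
    have h1 : |ρ ^ n * z + a - x| ≤ g := by
      rw [hxy, show ρ ^ n * z + a - (ρ ^ n * y + a) = ρ ^ n * (z - y) by ring, abs_mul,
        abs_of_pos hρn]
      nlinarith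
    rw [abs_le] at h1
    have h2 : g ≤ x - l := min_le_left _ _
    have h3 : g ≤ r - x := min_le_right _ _
    constructor <;> simp only <;> linarith [h1.1, h1.2]
  refine Measure.AbsolutelyContinuous.mk fun E hE h0 => ?_
  rw [Measure.restrict_apply hE] at h0
  have hlip : LipschitzWith (Real.toNNReal (ρ ^ n)) fun z : ℝ => ρ ^ n * z + a :=
    LipschitzWith.of_dist_le_mul fun u w => by
      rw [Real.dist_eq, Real.dist_eq, Real.coe_toNNReal _ hρn.le,
        show ρ ^ n * u + a - (ρ ^ n * w + a) = ρ ^ n * (u - w) by ring, abs_mul, abs_of_pos hρn]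
  have h1 : μH[s] ((fun z => ρ ^ n * z + a) '' (E ∩ K)) = 0 := by
    have := hlip.hausdorffMeasure_image_le hs (E ∩ K)
    rw [h0, mul_zero] at this
    exact le_antisymm this zero_le
  have h2 : μ ((fun z => ρ ^ n * z + a) '' (E ∩ K)) = 0 := by
    have h := hac h1
    rw [Measure.restrict_apply' measurableSet_Icc] at h
    rwa [Set.inter_eq_self_of_subset_left
      ((Set.image_mono Set.inter_subset_right).trans himg)] at h
  have h3 : μ (E ∩ K) = 0 := by
    refine measure_mono_null (Set.subset_preimage_image (fun z => ρ ^ n * z + a) _) ?_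
    exact le_antisymm ((Measure.le_map_apply (by fun_prop) _).trans (hmap h2).le) zero_le
  refine measure_mono_null (fun z hz => ?_) (measure_union_null h3 hcompl)
  by_cases hzK : z ∈ K
  · exact Or.inl ⟨hz, hzK⟩
  · exact Or.inr hzK

end SelfSimilar

section Intervals

variable {ι : Type*} {lo hi : ι → ℝ}

/-- A packing bound for intervals with disjoint interiors. -/
lemma card_mul_le_of_disjoint_Ioo {S : Finset ι} {g x y : ℝ} (hxy : x ≤ y)
    (hdisj : (S : Set ι).PairwiseDisjoint fun i => Set.Ioo (lo i) (hi i))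
    (hg : ∀ i ∈ S, g ≤ hi i - lo i) (hx : ∀ i ∈ S, x ≤ lo i) (hy : ∀ i ∈ S, hi i ≤ y) :
    (S.card : ℝ) * g ≤ y - x := by
  have h1 : ∑ i ∈ S, volume (Set.Ioo (lo i) (hi i)) ≤ volume (Set.Icc x y) := by
    rw [← measure_biUnion_finset hdisj fun _ _ => measurableSet_Ioo]
    refine measure_mono (Set.iUnion₂_subset fun i hi' => ?_)
    exact fun z hz => ⟨(hx i hi').trans hz.1.le, hz.2.le.trans (hy i hi')⟩
  have h2 : ∑ _i ∈ S, ENNReal.ofReal g ≤ ENNReal.ofReal (y - x) := by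
    rw [Real.volume_Icc] at h1
    refine le_trans (Finset.sum_le_sum fun i hi' => ?_) h1
    rw [Real.volume_Ioo]
    exact ENNReal.ofReal_le_ofReal (hg i hi')
  rcases le_total g 0 with hg0 | hg0
  · exact (mul_nonpos_of_nonneg_of_nonpos (Nat.cast_nonneg _) hg0).trans (by linarith)
  rw [Finset.sum_const, nsmul_eq_mul, ← ENNReal.ofReal_natCast,
    ← ENNReal.ofReal_mul (Nat.cast_nonneg _)] at h2
  exact (ENNReal.ofReal_le_ofReal_iff (by linarith)).1 h2

lemma sum_measureReal_Icc_le {μ : Measure ℝ} [IsFiniteMeasure μ] (hatom : ∀ x, μ {x} = 0)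
    {S : Finset ι} (hdisj : (S : Set ι).PairwiseDisjoint fun i => Set.Ioo (lo i) (hi i)) :
    ∑ i ∈ S, (μ (Set.Icc (lo i) (hi i))).toReal ≤
      (μ (⋃ i ∈ S, Set.Icc (lo i) (hi i))).toReal := by
  have : NullSingletonClass μ := ⟨hatom⟩
  rw [← ENNReal.toReal_sum fun _ _ => measure_ne_top μ _]
  refine ENNReal.toReal_mono (measure_ne_top μ _) ?_
  rw [Finset.sum_congr rfl fun i _ => (measure_congr (Ioo_ae_eq_Icc (μ := μ))).symm,
    ← measure_biUnion_finset hdisj fun _ _ => measurableSet_Ioo]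
  exact measure_mono (Set.iUnion₂_mono fun i _ => Set.Ioo_subset_Icc_self)

end Intervals

section NetIntervals

variable {k N : ℕ} {ρ s c2 c4 : ℝ} {K : Set ℝ} {μ : Measure ℝ}
  {M : Fin k → Matrix (Fin N) (Fin N) ℝ} {lo hi : List (Fin k) → ℝ}

/-- Net intervals `[lo w, hi w]`, indexed by the words `w` with `wordProd M w ≠ 0`, whose
`μ`-measure is comparable to the norm of `wordProd M w`. -/
structure NetIntervals (ρ c2 c4 : ℝ) (K : Set ℝ) (μ : Measure ℝ)
    (M : Fin k → Matrix (Fin N) (Fin N) ℝ) (lo hi : List (Fin k) → ℝ) : Prop where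
  disjoint : ∀ n,
    (admissibleWords M n : Set (List (Fin k))).PairwiseDisjoint fun w => Set.Ioo (lo w) (hi w)
  length_ge : ∀ n, ∀ w ∈ admissibleWords M n, c2⁻¹ * ρ ^ n ≤ hi w - lo w
  length_le : ∀ n, ∀ w ∈ admissibleWords M n, hi w - lo w ≤ c2 * ρ ^ n
  cover : ∀ n, K ∩ Set.Icc (lo []) (hi []) ⊆ ⋃ w ∈ admissibleWords M n, Set.Icc (lo w) (hi w)
  lo_mem : ∀ n, ∀ w ∈ admissibleWords M n, lo w ∈ K
  measure_ge : ∀ n, 1 ≤ n → ∀ w ∈ admissibleWords M n,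
    c4⁻¹ * mnorm (wordProd M w) ≤ (μ (Set.Icc (lo w) (hi w))).toReal
  measure_le : ∀ n, 1 ≤ n → ∀ w ∈ admissibleWords M n,
    (μ (Set.Icc (lo w) (hi w))).toReal ≤ c4 * mnorm (wordProd M w)

namespace NetIntervals

/-- Boundedly many net intervals of a given generation meet an interval of comparable length. -/
lemma card_le (h : NetIntervals ρ c2 c4 K μ M lo hi) (hρ0 : 0 < ρ) (hc2 : 0 < c2) {n : ℕ}
    {x : ℝ} {S : Finset (List (Fin k))} (hS : S ⊆ admissibleWords M n)
    (hx : ∀ w ∈ S, (Set.Icc (lo w) (hi w) ∩ Set.Icc (x - ρ ^ n) (x + ρ ^ n)).Nonempty) :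
    (S.card : ℝ) ≤ c2 * (2 + 2 * c2) := by
  have hρn : 0 < ρ ^ n := by positivity
  have hc : 0 < c2 * ρ ^ n := by positivity
  have key := card_mul_le_of_disjoint_Ioo (S := S) (lo := lo) (hi := hi) (g := c2⁻¹ * ρ ^ n)
    (x := x - ρ ^ n - c2 * ρ ^ n) (y := x + ρ ^ n + c2 * ρ ^ n) (by linarith)
    ((h.disjoint n).subset (by exact_mod_cast hS)) (fun w hw => h.length_ge n w (hS hw))
    (fun w hw => by
      obtain ⟨z, hz1, hz2⟩ := hx w hw
      linarith [h.length_le n w (hS hw), hz1.1, hz1.2, hz2.1, hz2.2])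
    (fun w hw => by
      obtain ⟨z, hz1, hz2⟩ := hx w hw
      linarith [h.length_le n w (hS hw), hz1.1, hz1.2, hz2.1, hz2.2])
  have e : (S.card : ℝ) * (c2⁻¹ * ρ ^ n) = (S.card : ℝ) / c2 * ρ ^ n := by ring
  have e' : x + ρ ^ n + c2 * ρ ^ n - (x - ρ ^ n - c2 * ρ ^ n) = (2 + 2 * c2) * ρ ^ n := by ring
  rw [e, e'] at key
  have := (div_le_iff₀ hc2).1 (le_of_mul_le_mul_right key hρn)
  linarith

lemma sum_measure_le (h : NetIntervals ρ c2 c4 K μ M lo hi) [IsProbabilityMeasure μ]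
    (hatom : ∀ x, μ {x} = 0) {n : ℕ} {S : Finset (List (Fin k))} (hS : S ⊆ admissibleWords M n) :
    ∑ w ∈ S, (μ (Set.Icc (lo w) (hi w))).toReal ≤
      (μ (⋃ w ∈ S, Set.Icc (lo w) (hi w))).toReal :=
  sum_measureReal_Icc_le hatom ((h.disjoint n).subset (by exact_mod_cast hS))

lemma sum_mnorm_le (h : NetIntervals ρ c2 c4 K μ M lo hi) [IsProbabilityMeasure μ]
    (hatom : ∀ x, μ {x} = 0) (hc4 : 0 < c4) {n : ℕ} (hn : 1 ≤ n) {S : Finset (List (Fin k))}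
    (hS : S ⊆ admissibleWords M n) :
    ∑ w ∈ S, mnorm (wordProd M w) ≤ c4 * (μ (⋃ w ∈ S, Set.Icc (lo w) (hi w))).toReal := by
  refine le_trans ?_ (mul_le_mul_of_nonneg_left (h.sum_measure_le hatom hS) hc4.le)
  rw [Finset.mul_sum]
  refine Finset.sum_le_sum fun w hw => ?_
  exact (inv_mul_le_iff₀ hc4).1 (h.measure_ge n hn w (hS hw))

lemma measure_inter_le (h : NetIntervals ρ c2 c4 K μ M lo hi) (hcompl : μ Kᶜ = 0) (n : ℕ)
    {S : Finset (List (Fin k))} {J : Set ℝ}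
    (hJ : ∀ w ∈ admissibleWords M n, (Set.Icc (lo w) (hi w) ∩ J).Nonempty → w ∈ S) :
    μ (J ∩ Set.Icc (lo []) (hi [])) ≤ ∑ w ∈ S, μ (Set.Icc (lo w) (hi w)) := by
  have hsub : J ∩ Set.Icc (lo []) (hi []) ⊆ Kᶜ ∪ ⋃ w ∈ S, Set.Icc (lo w) (hi w) := by
    intro z hz
    by_cases hzK : z ∈ K
    · obtain ⟨w, hw, hzw⟩ := Set.mem_iUnion₂.1 (h.cover n ⟨hzK, hz.2⟩)
      exact Or.inr (Set.mem_iUnion₂.2 ⟨w, hJ w hw ⟨z, hzw, hz.1⟩, hzw⟩)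
    · exact Or.inl hzK
  refine (measure_mono hsub).trans ((measure_union_le _ _).trans ?_)
  rw [hcompl, zero_add]
  exact measure_biUnion_finset_le _ _

lemma measure_le_sum (h : NetIntervals ρ c2 c4 K μ M lo hi) [IsProbabilityMeasure μ]
    (hcompl : μ Kᶜ = 0) (n : ℕ) :
    (μ (Set.Icc (lo []) (hi []))).toReal ≤
      ∑ w ∈ admissibleWords M n, (μ (Set.Icc (lo w) (hi w))).toReal := by
  rw [← ENNReal.toReal_sum fun _ _ => measure_ne_top μ _]
  refine ENNReal.toReal_mono (ENNReal.sum_ne_top.2 fun _ _ => measure_ne_top μ _) ?_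
  have := h.measure_inter_le hcompl n (S := admissibleWords M n) (J := Set.univ)
    fun w hw _ => hw
  rwa [Set.univ_inter] at this

/-- If the exponential growth rate of the number of net intervals is `s * log (1 / ρ)`, then a
uniform Lyapunov exponent is at most `log (ρ ^ s)`. -/
lemma exp_lyapunov_le (h : NetIntervals ρ c2 c4 K μ M lo hi) [IsProbabilityMeasure μ]
    (hatom : ∀ x, μ {x} = 0) (hcompl : μ Kᶜ = 0) (hpos : μ (Set.Icc (lo []) (hi [])) ≠ 0)
    (hρ0 : 0 < ρ) (hρ1 : ρ < 1) (hc4 : 0 < c4)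
    {C lam htop : ℝ} (hC : 0 < C)
    (hlam : ∀ n, 1 ≤ n → ∀ w ∈ admissibleWords M n,
      C⁻¹ * Real.exp (lam * n) ≤ mnorm (wordProd M w))
    (hht : Tendsto (fun n : ℕ => (n : ℝ)⁻¹ * Real.log (admissibleWords M n).card) atTop
      (nhds htop))
    (hdim : s = htop / Real.log (1 / ρ)) : Real.exp lam ≤ ρ ^ s := by
  have hbound : ∀ n : ℕ, 1 ≤ n →
      (n : ℝ)⁻¹ * Real.log (admissibleWords M n).card ≤ (n : ℝ)⁻¹ * Real.log (c4 * C) - lam := by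
    intro n hn
    have hn0 : (0 : ℝ) < n := by exact_mod_cast hn
    have hne : (admissibleWords M n).Nonempty := by
      by_contra hne
      have h1 := h.measure_le_sum hcompl n
      rw [Finset.not_nonempty_iff_eq_empty.1 hne, Finset.sum_empty] at h1
      exact absurd h1 (not_le.2 (ENNReal.toReal_pos hpos (measure_ne_top μ _)))
    have hcard : (0 : ℝ) < (admissibleWords M n).card := by exact_mod_cast hne.card_pos
    have h1 : (admissibleWords M n).card * (C⁻¹ * Real.exp (lam * n)) ≤ c4 := by
      calc (admissibleWords M n).card * (C⁻¹ * Real.exp (lam * n))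
          = ∑ _w ∈ admissibleWords M n, C⁻¹ * Real.exp (lam * n) := by
            rw [Finset.sum_const, nsmul_eq_mul]
        _ ≤ ∑ w ∈ admissibleWords M n, mnorm (wordProd M w) := Finset.sum_le_sum (hlam n hn)
        _ ≤ c4 * (μ _).toReal := h.sum_mnorm_le hatom hc4 hn subset_rfl
        _ ≤ c4 * 1 := mul_le_mul_of_nonneg_left
            (ENNReal.toReal_le_of_le_ofReal zero_le_one (by simpa using prob_le_one)) hc4.le
        _ = c4 := mul_one _
    have h2 : (admissibleWords M n).card ≤ c4 * C * Real.exp (-(lam * n)) := by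
      rw [Real.exp_neg]
      have hE := Real.exp_pos (lam * n)
      rw [← div_eq_mul_inv, le_div_iff₀ hE]
      have h3 := mul_le_mul_of_nonneg_right h1 hC.le
      calc ((admissibleWords M n).card : ℝ) * Real.exp (lam * n)
          = (admissibleWords M n).card * (C⁻¹ * Real.exp (lam * n)) * C := by field_simp
        _ ≤ _ := h3
    have h3 := Real.log_le_log hcard h2
    rw [Real.log_mul (by positivity) (Real.exp_pos _).ne', Real.log_exp] at h3
    calc (n : ℝ)⁻¹ * Real.log (admissibleWords M n).card
        ≤ (n : ℝ)⁻¹ * (Real.log (c4 * C) + -(lam * n)) :=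
          mul_le_mul_of_nonneg_left h3 (by positivity)
      _ = _ := by field_simp; ring
  have hlim : Tendsto (fun n : ℕ => (n : ℝ)⁻¹ * Real.log (c4 * C) - lam) atTop
      (nhds (0 * Real.log (c4 * C) - lam)) :=
    (tendsto_natCast_atTop_atTop.inv_tendsto_atTop.mul_const _).sub_const _
  have h1 : htop ≤ 0 * Real.log (c4 * C) - lam :=
    le_of_tendsto_of_tendsto hht hlim ((eventually_ge_atTop 1).mono hbound)
  have hlog : Real.log ρ < 0 := Real.log_neg hρ0 hρ1
  have h2 : htop = s * -Real.log ρ := by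
    rw [hdim, one_div, Real.log_inv, div_mul_cancel₀ _ (by linarith)]
  rw [Real.rpow_def_of_pos hρ0, Real.exp_le_exp]
  linarith

lemma absolutelyContinuous_restrict (h : NetIntervals ρ c2 c4 K μ M lo hi)
    [IsProbabilityMeasure μ] (hatom : ∀ x, μ {x} = 0) (hcompl : μ Kᶜ = 0) (hρ0 : 0 < ρ)
    (hρ1 : ρ < 1) (hs : 0 ≤ s) (hc2 : 0 < c2) (hc4 : 0 < c4) {C : ℝ} (hC : 0 < C)
    (hM : ∀ n, 1 ≤ n → ∀ w ∈ admissibleWords M n, mnorm (wordProd M w) ≤ C * (ρ ^ s) ^ n) :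
    μ.restrict (Set.Icc (lo []) (hi [])) ≪ μH[s] := by
  classical
  refine absolutelyContinuous_hausdorffMeasure (C := c2 * (2 + 2 * c2) * (c4 * C)) hρ0 hρ1 hs
    (by positivity) (fun x => Measure.absolutelyContinuous_of_le Measure.restrict_le_self (hatom x))
    fun x n hn => ?_
  rw [Measure.restrict_apply measurableSet_Icc]
  set J := Set.Icc (x - ρ ^ n) (x + ρ ^ n) with hJ
  set S := (admissibleWords M n).filter fun w => (Set.Icc (lo w) (hi w) ∩ J).Nonempty with hS
  refine (h.measure_inter_le hcompl n (S := S) fun w hw hne =>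
    Finset.mem_filter.2 ⟨hw, hne⟩).trans ?_
  have h1 : ∀ w ∈ S, μ (Set.Icc (lo w) (hi w)) ≤ ENNReal.ofReal (c4 * C * (ρ ^ s) ^ n) := by
    intro w hw
    have hw' := (Finset.mem_filter.1 hw).1
    rw [← ENNReal.ofReal_toReal (measure_ne_top μ (Set.Icc (lo w) (hi w)))]
    refine ENNReal.ofReal_le_ofReal ((h.measure_le n hn w hw').trans ?_)
    rw [mul_assoc]
    exact mul_le_mul_of_nonneg_left (hM n hn w hw') hc4.le
  refine (Finset.sum_le_sum h1).trans ?_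
  rw [Finset.sum_const, nsmul_eq_mul, ← ENNReal.ofReal_natCast,
    ← ENNReal.ofReal_mul (Nat.cast_nonneg _), mul_assoc (c2 * _)]
  refine ENNReal.ofReal_le_ofReal (mul_le_mul_of_nonneg_right ?_ (by positivity))
  exact h.card_le hρ0 hc2 (Finset.filter_subset _ _) fun w hw => (Finset.mem_filter.1 hw).2

end NetIntervals

end NetIntervals

section UniformIntegrability

variable {k N : ℕ} {ρ s c c2 c4 : ℝ} {K : Set ℝ} {μ : Measure ℝ}
  {M : Fin k → Matrix (Fin N) (Fin N) ℝ} {lo hi : List (Fin k) → ℝ}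

/-- An absolutely continuous finite measure is uniformly absolutely continuous. -/
lemma exists_forall_measure_le_of_absolutelyContinuous {α : Type*} [MeasurableSpace α]
    {μ η : Measure α} [IsFiniteMeasure μ] [IsFiniteMeasure η] (hac : μ ≪ η) {ε : ℝ} (hε : 0 < ε) :
    ∃ δ : ℝ, 0 < δ ∧ ∀ E, η E ≤ ENNReal.ofReal δ → (μ E).toReal ≤ ε := by
  obtain ⟨δ, hδ0, hδ⟩ := exists_pos_setLIntegral_lt_of_measure_lt (μ := η)
    (f := μ.rnDeriv η) (Measure.lintegral_rnDeriv_lt_top μ η).ne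
    (ε := ENNReal.ofReal ε) (ENNReal.ofReal_pos.2 hε).ne'
  obtain ⟨δ', hδ'0, hδ'⟩ := ENNReal.lt_iff_exists_nnreal_btwn.1 hδ0
  refine ⟨δ', by exact_mod_cast hδ'0, fun E hE => ?_⟩
  rw [ENNReal.ofReal_coe_nnreal] at hE
  have := hδ E (hE.trans_lt hδ')
  rw [Measure.setLIntegral_rnDeriv hac] at this
  exact ENNReal.toReal_le_of_le_ofReal hε.le this.le

namespace NetIntervals

lemma exists_card_mul_le (h : NetIntervals ρ c2 c4 K μ M lo hi) (hρ0 : 0 < ρ) (hρ1 : ρ < 1)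
    (hc2 : 0 < c2) (hc : 0 < c) (hH : μH[s] K < ⊤)
    (hreg : ∀ x ∈ K, ∀ r : ℝ, 0 < r → r < 1 →
      ENNReal.ofReal (c⁻¹ * r ^ s) ≤ μH[s] (K ∩ Set.Icc (x - r) (x + r))) :
    ∃ C : ℝ, ∀ n, ((admissibleWords M n).card : ℝ) * (ρ ^ s) ^ n ≤ C := by
  classical
  set D : ℝ := c2 * (2 + 2 * c2) with hD
  have hD0 : 0 < D := by positivity
  refine ⟨D * (μH[s] K).toReal * (2 ^ s * c), fun n => ?_⟩
  have hρn : 0 < ρ ^ n := by positivity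
  have hρn1 : ρ ^ n ≤ 1 := pow_le_one₀ hρ0.le hρ1.le
  set B : List (Fin k) → Set ℝ := fun w => Set.Icc (lo w - ρ ^ n / 2) (lo w + ρ ^ n / 2) with hB
  have hlow : ∀ w ∈ admissibleWords M n,
      ENNReal.ofReal (c⁻¹ * ((ρ ^ s) ^ n / 2 ^ s)) ≤ (μH[s]).restrict K (B w) := by
    intro w hw
    rw [Measure.restrict_apply measurableSet_Icc, Set.inter_comm]
    have := hreg (lo w) (h.lo_mem n w hw) (ρ ^ n / 2) (by positivity) (by linarith)
    rwa [Real.div_rpow hρn.le zero_le_two, ← Real.rpow_pow_comm hρ0.le] at this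
  have hpt : ∀ x : ℝ, ∑ w ∈ admissibleWords M n, (B w).indicator 1 x ≤ ENNReal.ofReal D := by
    intro x
    have : ∑ w ∈ admissibleWords M n, (B w).indicator (1 : ℝ → ENNReal) x =
        ((admissibleWords M n).filter fun w => x ∈ B w).card := by
      rw [Finset.card_filter, Nat.cast_sum]
      refine Finset.sum_congr rfl fun w _ => ?_
      by_cases hx : x ∈ B w <;> simp [hx]
    rw [this, ← ENNReal.ofReal_natCast]
    refine ENNReal.ofReal_le_ofReal (h.card_le (x := x) hρ0 hc2 (Finset.filter_subset _ _)
      fun w hw => ⟨lo w, ⟨le_rfl, ?_⟩, ?_⟩)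
    · have h1 := h.length_ge n w (Finset.mem_filter.1 hw).1
      have : 0 < c2⁻¹ * ρ ^ n := by positivity
      linarith
    · have hx := (Finset.mem_filter.1 hw).2
      exact ⟨by linarith [hx.2], by linarith [hx.1]⟩
  have hsum : ∑ w ∈ admissibleWords M n, (μH[s]).restrict K (B w) ≤
      ENNReal.ofReal D * μH[s] K := by
    calc ∑ w ∈ admissibleWords M n, (μH[s]).restrict K (B w)
        = ∑ w ∈ admissibleWords M n, ∫⁻ x, (B w).indicator 1 x ∂(μH[s]).restrict K :=
          Finset.sum_congr rfl fun w _ => (lintegral_indicator_one measurableSet_Icc).symm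
      _ = ∫⁻ x, ∑ w ∈ admissibleWords M n, (B w).indicator 1 x ∂(μH[s]).restrict K :=
          (lintegral_finsetSum _ fun w _ => measurable_one.indicator measurableSet_Icc).symm
      _ ≤ ∫⁻ _, ENNReal.ofReal D ∂(μH[s]).restrict K := lintegral_mono hpt
      _ = ENNReal.ofReal D * μH[s] K := by rw [lintegral_const, Measure.restrict_apply_univ]
  have key := (Finset.sum_le_sum hlow).trans hsum
  rw [Finset.sum_const, nsmul_eq_mul, ← ENNReal.ofReal_natCast,
    ← ENNReal.ofReal_mul (Nat.cast_nonneg _), ← ENNReal.ofReal_toReal hH.ne,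
    ← ENNReal.ofReal_mul hD0.le, ENNReal.ofReal_le_ofReal_iff (by positivity)] at key
  have h2s : (0 : ℝ) < 2 ^ s := by positivity
  calc ((admissibleWords M n).card : ℝ) * (ρ ^ s) ^ n
      = (admissibleWords M n).card * (c⁻¹ * ((ρ ^ s) ^ n / 2 ^ s)) * (2 ^ s * c) := by
        field_simp
    _ ≤ _ := mul_le_mul_of_nonneg_right key (by positivity)

lemma exists_hausdorffMeasure_le (h : NetIntervals ρ c2 c4 K μ M lo hi) (hρ0 : 0 < ρ)
    (hs : 0 ≤ s) (hc2 : 0 < c2) (hc : 0 < c) (hH : μH[s] K < ⊤)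
    (hreg : ∀ x ∈ K, ∀ r : ℝ, 0 < r → r < 1 →
      μH[s] (K ∩ Set.Icc (x - r) (x + r)) ≤ ENNReal.ofReal (c * r ^ s)) :
    ∃ C : ℝ, 0 < C ∧ ∀ n, ∀ w ∈ admissibleWords M n,
      (μH[s]).restrict K (Set.Icc (lo w) (hi w)) ≤ ENNReal.ofReal (C * (ρ ^ s) ^ n) := by
  refine ⟨(c + (μH[s] K).toReal) * c2 ^ s, by positivity, fun n w hw => ?_⟩
  have hρn : 0 < ρ ^ n := by positivity
  have hr : 0 < c2 * ρ ^ n := by positivity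
  have e : (c2 * ρ ^ n) ^ s = c2 ^ s * (ρ ^ s) ^ n := by
    rw [Real.mul_rpow hc2.le hρn.le, Real.rpow_pow_comm hρ0.le]
  rw [mul_assoc, ← e, Measure.restrict_apply measurableSet_Icc]
  have hp : 0 < (c2 * ρ ^ n) ^ s := by positivity
  rcases lt_or_ge (c2 * ρ ^ n) 1 with h1 | h1
  · have hsub : Set.Icc (lo w) (hi w) ∩ K ⊆
        K ∩ Set.Icc (lo w - c2 * ρ ^ n) (lo w + c2 * ρ ^ n) := fun z hz =>
      ⟨hz.2, by linarith [hz.1.1], by linarith [hz.1.2, h.length_le n w hw]⟩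
    refine (measure_mono hsub).trans ((hreg _ (h.lo_mem n w hw) _ hr h1).trans
      (ENNReal.ofReal_le_ofReal (mul_le_mul_of_nonneg_right ?_ hp.le)))
    linarith [ENNReal.toReal_nonneg (a := μH[s] K)]
  · refine (measure_mono Set.inter_subset_right).trans ?_
    have h2 : 1 ≤ (c2 * ρ ^ n) ^ s := Real.one_le_rpow h1 hs
    calc μH[s] K = ENNReal.ofReal (μH[s] K).toReal := (ENNReal.ofReal_toReal hH.ne).symm
      _ ≤ _ := ENNReal.ofReal_le_ofReal (by
        have := ENNReal.toReal_nonneg (a := μH[s] K)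
        nlinarith)

lemma hasULE_of_absolutelyContinuous [NeZero N] (h : NetIntervals ρ c2 c4 K μ M lo hi)
    (hM : PosIrred M) [IsProbabilityMeasure μ] (hatom : ∀ x, μ {x} = 0) (hcompl : μ Kᶜ = 0)
    (hpos : μ (Set.Icc (lo []) (hi [])) ≠ 0) (hρ0 : 0 < ρ) (hρ1 : ρ < 1) (hs : 0 ≤ s)
    (hc2 : 0 < c2) (hc4 : 0 < c4) (hc : 0 < c) (hH : μH[s] K < ⊤)
    (hreg : ∀ x ∈ K, ∀ r : ℝ, 0 < r → r < 1 →
      ENNReal.ofReal (c⁻¹ * r ^ s) ≤ μH[s] (K ∩ Set.Icc (x - r) (x + r)) ∧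
      μH[s] (K ∩ Set.Icc (x - r) (x + r)) ≤ ENNReal.ofReal (c * r ^ s))
    (hac : μ ≪ (μH[s]).restrict K) : HasULE M := by
  classical
  obtain ⟨C₁, hC₁⟩ := h.exists_card_mul_le hρ0 hρ1 hc2 hc hH fun x hx r h0 h1 =>
    (hreg x hx r h0 h1).1
  obtain ⟨C₂, hC₂0, hC₂⟩ := h.exists_hausdorffMeasure_le hρ0 hs hc2 hc hH fun x hx r h0 h1 =>
    (hreg x hx r h0 h1).2
  have hsum : ∀ n, mnorm ((∑ i, M i) ^ n) = ∑ w ∈ admissibleWords M n, mnorm (wordProd M w) := by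
    intro n
    rw [← sum_mnorm_wordProd hM.1]
    refine (Finset.sum_subset (fun w hw => ?_) fun w hw hw' => ?_).symm
    · exact mem_wordsOfLength.2 (mem_admissibleWords.1 hw).1
    · rw [mem_admissibleWords] at hw'
      push Not at hw'
      exact mnorm_eq_zero_iff.2 (hw' (mem_wordsOfLength.1 hw))
  have hprob : ∀ E, (μ E).toReal ≤ 1 := fun E =>
    ENNReal.toReal_le_of_le_ofReal zero_le_one (by simpa using prob_le_one)
  have hm0 : 0 < (μ (Set.Icc (lo []) (hi []))).toReal := ENNReal.toReal_pos hpos (measure_ne_top μ _)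
  set a := c4⁻¹ * (μ (Set.Icc (lo []) (hi []))).toReal with ha
  have ha0 : 0 < a := by positivity
  have ht0 : 0 < ρ ^ s := by positivity
  refine hasULE_of_uniformIntegrable hM (t := ρ ^ s) (c := min a 1)
    (C := max (max c4 (mnorm (1 : Matrix (Fin N) (Fin N) ℝ))) C₁) ht0
    (Real.rpow_le_one hρ0.le hρ1.le hs) (lt_min ha0 one_pos) (fun n => ?_) (fun n => ?_)
    (fun n => (hC₁ n).trans (le_max_right _ _)) fun ε hε => ?_
  · rcases Nat.eq_zero_or_pos n with rfl | hn
    · rw [pow_zero]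
      exact (min_le_right _ _).trans mnorm_one
    · refine (min_le_left _ _).trans ?_
      rw [hsum, ha, inv_mul_le_iff₀ hc4, Finset.mul_sum]
      exact (h.measure_le_sum hcompl n).trans (Finset.sum_le_sum (h.measure_le n hn))
  · refine le_trans ?_ (le_max_left _ _)
    rcases Nat.eq_zero_or_pos n with rfl | hn
    · rw [pow_zero]
      exact le_max_right _ _
    · refine le_trans ?_ (le_max_left _ _)
      rw [hsum]
      refine (h.sum_mnorm_le hatom hc4 hn subset_rfl).trans ?_
      exact mul_le_of_le_one_right hc4.le (hprob _)
  · have : IsFiniteMeasure ((μH[s]).restrict K) := ⟨by rwa [Measure.restrict_apply_univ]⟩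
    obtain ⟨δ, hδ0, hδ⟩ := exists_forall_measure_le_of_absolutelyContinuous hac (div_pos hε hc4)
    refine ⟨δ / C₂, div_pos hδ0 hC₂0, fun n hn S hS hcard => ?_⟩
    refine (h.sum_mnorm_le hatom hc4 hn hS).trans ?_
    rw [← le_div_iff₀' hc4]
    refine hδ _ ((measure_biUnion_finset_le _ _).trans ?_)
    refine (Finset.sum_le_sum fun w hw => hC₂ n w (hS hw)).trans ?_
    rw [Finset.sum_const, nsmul_eq_mul, ← ENNReal.ofReal_natCast,
      ← ENNReal.ofReal_mul (Nat.cast_nonneg _)]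
    refine ENNReal.ofReal_le_ofReal ?_
    rw [le_div_iff₀ hC₂0] at hcard
    linarith

end NetIntervals

end UniformIntegrability

section Main

variable {k N : ℕ}

lemma PosIrred.exists_ne_zero [NeZero N] {M : Fin k → Matrix (Fin N) (Fin N) ℝ}
    (hM : PosIrred M) : ∃ i, M i ≠ 0 := by
  by_contra! h0
  obtain ⟨ℓ, -, hpos⟩ := hM.2
  have h := hpos 0 0
  rw [Finset.sum_congr rfl fun j hj => show (∑ i, M i) ^ j = 0 by
    rw [Finset.sum_eq_zero fun i _ => h0 i, zero_pow (by have := (Finset.mem_Icc.1 hj).1; omega)],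
    Finset.sum_const_zero] at h
  exact lt_irrefl _ h

lemma Adm.nil {A : Matrix (Fin k) (Fin k) ℝ} {w : List (Fin k)} (h : Adm A w) : Adm A [] := by
  obtain ⟨x, hx, p, -⟩ := h
  exact ⟨x, hx, p, fun i => i.elim0⟩

end Main

theorem stmt19 {m k N : ℕ} [NeZero m] [NeZero k] [NeZero N]
    (ρ : ℝ) (hρ0 : 0 < ρ) (hρ1 : ρ < 1)
    (b : Fin m → ℝ) (hb : StrictMono b)
    (K : Set ℝ) (hKne : K.Nonempty) (hKcpt : IsCompact K)
    (hK : K = ⋃ j, (fun x => ρ * x + b j) '' K)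
    (p : Fin m → ℝ) (hp : ∀ j, 0 < p j) (hpsum : ∑ j, p j = 1)
    (μ : Measure ℝ) [IsProbabilityMeasure μ]
    (hself : μ = ∑ j, ENNReal.ofReal (p j) • μ.map fun x => ρ * x + b j)
    (hatom : ∀ x : ℝ, μ {x} = 0)
    (s : ℝ) (hs0 : 0 ≤ s) (hs : dimH K = ENNReal.ofReal s)
    (hH0 : 0 < μH[s] K) (hH1 : μH[s] K < ⊤)
    (c : ℝ) (hc : 0 < c)
    (hreg : ∀ x ∈ K, ∀ r : ℝ, 0 < r → r < 1 →
      ENNReal.ofReal (c⁻¹ * r ^ s) ≤ μH[s] (K ∩ Set.Icc (x - r) (x + r)) ∧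
      μH[s] (K ∩ Set.Icc (x - r) (x + r)) ≤ ENNReal.ofReal (c * r ^ s))
    (A : Matrix (Fin k) (Fin k) ℝ)
    (hA01 : ∀ i j, A i j = 0 ∨ A i j = 1)
    (hAirr : PosIrredMat A)
    (M : Fin k → Matrix (Fin N) (Fin N) ℝ)
    (hMpos : PosIrred M)
    (lo hi : List (Fin k) → ℝ)
    (hlohi : ∀ w, Adm A w → lo w ≤ hi w)
    -- (C1)
    (hC1a : ∀ (nn : ℕ) (w w' : List (Fin k)), w.length = nn → w'.length = nn →
      Adm A w → Adm A w' → w ≠ w' →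
      Set.Ioo (lo w) (hi w) ∩ Set.Ioo (lo w') (hi w') = ∅)
    (hC1b : ∀ w, Adm A w → Set.Icc (lo w) (hi w) ⊆ Set.Icc (lo []) (hi []))
    (hC1c : ∀ w, Adm A w → w ≠ [] →
      Set.Icc (lo w) (hi w) ⊆ Set.Icc (lo w.dropLast) (hi w.dropLast))
    -- (C2)
    (c2 : ℝ) (hc2 : 0 < c2)
    (hC2 : ∀ w, Adm A w →
      c2⁻¹ * ρ ^ w.length ≤ hi w - lo w ∧ hi w - lo w ≤ c2 * ρ ^ w.length)
    -- (C3)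
    (hC3 : ∀ nn : ℕ, K ∩ Set.Icc (lo []) (hi []) =
      K ∩ ⋃ w ∈ {w : List (Fin k) | w.length = nn ∧ Adm A w}, Set.Icc (lo w) (hi w))
    (hC3b : ∀ w, Adm A w → lo w ∈ K ∧ hi w ∈ K)
    -- (C4)
    (c4 : ℝ) (hc4 : 0 < c4)
    (hC4 : ∀ w, Adm A w → w ≠ [] →
      c4⁻¹ * mnorm (wordProd M w) ≤ (μ (Set.Icc (lo w) (hi w))).toReal ∧
      (μ (Set.Icc (lo w) (hi w))).toReal ≤ c4 * mnorm (wordProd M w))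
    -- (C5)
    (hC5 : ∀ w : List (Fin k), w ≠ [] → (wordProd M w ≠ 0 ↔ Adm A w))
    -- entropy and dimension
    (htop : ℝ)
    (hht : Tendsto (fun nn : ℕ =>
        (nn : ℝ)⁻¹ * Real.log (Set.ncard {w : List (Fin k) | w.length = nn ∧ Adm A w}))
      atTop (nhds htop))
    (hdim : s = htop / Real.log (1 / ρ)) :
    μ ≪ (μH[s]).restrict K ↔ HasULE M := by
  have hcompl := measure_compl_attractor hρ0 hρ1 hKne hKcpt hK hp hpsum hself
  obtain ⟨i, hi0⟩ := hMpos.exists_ne_zero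
  have hi1 : wordProd M [i] ≠ 0 := by simpa [wordProd] using hi0
  have hadm1 : Adm A [i] := (hC5 [i] (by simp)).1 hi1
  have hadm : ∀ w, wordProd M w ≠ 0 ↔ Adm A w := by
    intro w
    rcases eq_or_ne w [] with rfl | hw
    · simp [wordProd_nil, hadm1.nil]
    · exact hC5 w hw
  have hmem : ∀ n w, w ∈ admissibleWords M n ↔ w.length = n ∧ Adm A w := fun n w => by
    rw [mem_admissibleWords, hadm]
  have hne : ∀ n, 1 ≤ n → ∀ w ∈ admissibleWords M n, w ≠ [] := by
    rintro n hn w hw rfl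
    have := ((hmem n []).1 hw).1
    simp only [List.length_nil] at this
    omega
  have h : NetIntervals ρ c2 c4 K μ M lo hi :=
    { disjoint := fun n w hw w' hw' hww' => Set.disjoint_iff_inter_eq_empty.2 <| by
        have h1 := (hmem n w).1 hw
        have h2 := (hmem n w').1 hw'
        exact hC1a n w w' h1.1 h2.1 h1.2 h2.2 hww'
      length_ge := fun n w hw => by
        obtain ⟨rfl, hw'⟩ := (hmem n w).1 hw
        exact (hC2 w hw').1
      length_le := fun n w hw => by
        obtain ⟨rfl, hw'⟩ := (hmem n w).1 hw
        exact (hC2 w hw').2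
      cover := fun n x hx => by
        rw [hC3 n] at hx
        obtain ⟨w, hw, hxw⟩ := Set.mem_iUnion₂.1 hx.2
        exact Set.mem_iUnion₂.2 ⟨w, (hmem n w).2 hw, hxw⟩
      lo_mem := fun n w hw => (hC3b w ((hmem n w).1 hw).2).1
      measure_ge := fun n hn w hw => (hC4 w ((hmem n w).1 hw).2 (hne n hn w hw)).1
      measure_le := fun n hn w hw => (hC4 w ((hmem n w).1 hw).2 (hne n hn w hw)).2 }
  have hpos : μ (Set.Icc (lo []) (hi [])) ≠ 0 := by
    intro h0
    have h1 := (hC4 [i] hadm1 (by simp)).1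
    rw [measure_mono_null (hC1b [i] hadm1) h0, ENNReal.toReal_zero] at h1
    have h2 : 0 < c4⁻¹ * mnorm (wordProd M [i]) := mul_pos (inv_pos.2 hc4) (mnorm_pos_iff.2 hi1)
    linarith
  refine ⟨h.hasULE_of_absolutelyContinuous hMpos hatom hcompl hpos hρ0 hρ1 hs0 hc2 hc4 hc hH1 hreg,
    fun ⟨C, hC, lam, hCl⟩ => ?_⟩
  have hule : ∀ n, 1 ≤ n → ∀ w ∈ admissibleWords M n,
      C⁻¹ * Real.exp (lam * n) ≤ mnorm (wordProd M w) ∧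
        mnorm (wordProd M w) ≤ C * Real.exp (lam * n) := by
    intro n hn w hw
    obtain ⟨rfl, hw0⟩ := mem_admissibleWords.1 hw
    exact (hCl w (hne _ hn w hw)).resolve_left hw0
  have hcard : ∀ n, Set.ncard {w : List (Fin k) | w.length = n ∧ Adm A w} =
      (admissibleWords M n).card := by
    intro n
    rw [← Set.ncard_coe_finset]
    congr 1
    ext w
    exact (hmem n w).symm
  simp only [hcard] at hht
  have hexp := h.exp_lyapunov_le hatom hcompl hpos hρ0 hρ1 hc4 hC
    (fun n hn w hw => (hule n hn w hw).1) hht hdim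
  have hac := h.absolutelyContinuous_restrict hatom hcompl hρ0 hρ1 hs0 hc2 hc4 hC
    fun n hn w hw => (hule n hn w hw).2.trans <| by
      rw [mul_comm lam, Real.exp_nat_mul]
      exact mul_le_mul_of_nonneg_left (pow_le_pow_left₀ (Real.exp_pos _).le hexp n) hC.le
  have : NullSingletonClass μ := ⟨hatom⟩
  refine absolutelyContinuous_of_restrict hρ0 hρ1 hKne hKcpt hK hp hpsum hself hs0 ?_ hac
  rwa [measure_congr Ioo_ae_eq_Icc]
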